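/- arXiv:1607.04529 — 2 statements merged into one kernel-verified Lean document; each statement's English description precedes it below -/
import Mathlib

section
/- Let (R,𝔪) be a complete Noetherian local ring, 𝔞 ⊊ R a proper ideal, and M a finite R-module that is relative Cohen-Macaulay with respect to 𝔞 with c = cd(𝔞,M) > 0 and Supp_R(M/𝔞M) ⊆ V(𝔪). Then 𝔞 contains a regular element (non-zerodivisor) on D_R(H^c_𝔞(M)). -/
open CategoryTheory

noncomputable section

/-- The cohomological dimension `cd(𝔞, M)`: the supremum (in `ℕ`) of the set of
indices `i` with `H^i_𝔞(M) ≠ 0`, local cohomology being taken w.r.t. `𝔞`. -/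
def cohDim {R : Type} [CommRing R] (I : Ideal R) (M : Type) [AddCommGroup M] [Module R M] : ℕ :=
  sSup {i : ℕ | Nontrivial ((localCohomology I i).obj (ModuleCat.of R M))}

/-- `M` is relative Cohen-Macaulay w.r.t. `𝔞` if there is precisely one non-vanishing
local cohomology module of `M` w.r.t. `𝔞`. -/
def IsRelCM {R : Type} [CommRing R] (I : Ideal R) (M : Type) [AddCommGroup M] [Module R M] :
    Prop :=
  ∃ c : ℕ, ∀ i : ℕ, Nontrivial ((localCohomology I i).obj (ModuleCat.of R M)) ↔ i = c

/-- `f : K →ₗ[R] E` exhibits `E` as an injective hull of `K`: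
`E` is an injective module and `f` is an essential monomorphism. -/
structure IsInjectiveHull (R : Type) [CommRing R] {K E : Type} [AddCommGroup K] [Module R K]
    [AddCommGroup E] [Module R E] (f : K →ₗ[R] E) : Prop where
  injective : Module.Injective R E
  inj : Function.Injective f
  essential : ∀ N : Submodule R E, N ≠ ⊥ → N ⊓ LinearMap.range f ≠ ⊥

/-- `F` is the cohomological dimension filtration (cd-filtration) of `M` in the range
`0 ≤ i ≤ c`: `F i` is the largest submodule of `M` of cohomological dimension `≤ i`. -/
def IsCdFiltration {R : Type} [CommRing R] (I : Ideal R) {M : Type} [AddCommGroup M]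
    [Module R M] (c : ℕ) (F : ℕ → Submodule R M) : Prop :=
  ∀ i ≤ c, cohDim I (F i) ≤ i ∧ ∀ N : Submodule R M, cohDim I N ≤ i → N ≤ F i

/-- The `i`-th factor `M_i / M_{i-1}` of a filtration `F` of `M`. -/
def filtFactor {R : Type} [CommRing R] {M : Type} [AddCommGroup M] [Module R M]
    (F : ℕ → Submodule R M) (i : ℕ) : Type :=
  ↥(F i) ⧸ Submodule.comap (F i).subtype (F (i - 1))

instance {R : Type} [CommRing R] {M : Type} [AddCommGroup M] [Module R M]
    (F : ℕ → Submodule R M) (i : ℕ) : AddCommGroup (filtFactor F i) :=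
  inferInstanceAs (AddCommGroup (↥(F i) ⧸ Submodule.comap (F i).subtype (F (i - 1))))

instance {R : Type} [CommRing R] {M : Type} [AddCommGroup M] [Module R M]
    (F : ℕ → Submodule R M) (i : ℕ) : Module R (filtFactor F i) :=
  inferInstanceAs (Module R (↥(F i) ⧸ Submodule.comap (F i).subtype (F (i - 1))))

/-- `M` is a relative Cohen-Macaulay filtered (RCMF) module w.r.t. `𝔞`: every factor
`M_i/M_{i-1}` (`1 ≤ i ≤ c = cd(𝔞,M)`) of its cd-filtration is either zero or an
`i`-cohomological dimensional relative Cohen-Macaulay module w.r.t. `𝔞`. -/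
def IsRCMF {R : Type} [CommRing R] (I : Ideal R) (M : Type) [AddCommGroup M] [Module R M] :
    Prop :=
  ∀ F : ℕ → Submodule R M, IsCdFiltration I (cohDim I M) F →
    ∀ i : ℕ, 1 ≤ i → i ≤ cohDim I M →
      Subsingleton (filtFactor F i) ∨
        (IsRelCM I (filtFactor F i) ∧ cohDim I (filtFactor F i) = i)

end

namespace LCAux
open Limits Opposite
noncomputable section


section LeftDerived
universe v1 v2 u1 u2
variable {C : Type u1} [Category.{v1} C] [Abelian C]
  {D : Type u2} [Category.{v2} D] [Abelian D]
  {F G K : C ⥤ D} [F.Additive] [G.Additive] [K.Additive] (α : F ⟶ G) (β : G ⟶ K)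

/-- Exactness on projectives of a pair of natural transformations. -/
structure SESProj : Prop where
  w : α ≫ β = 0
  ex : ∀ (P : C) [Projective P],
    (ShortComplex.mk (α.app P) (β.app P) (by rw [← NatTrans.comp_app, w]; rfl)).ShortExact

variable {α β}

/-- Value of an additive functor on a resolution. -/
abbrev cx (F : C ⥤ D) [F.Additive] {X : C} (P : ProjectiveResolution X) : ChainComplex D ℕ :=
  (F.mapHomologicalComplex _).obj P.complex

/-- Map on values. -/
abbrev cxMap (α : F ⟶ G) {X : C} (P : ProjectiveResolution X) : cx F P ⟶ cx G P :=
  (NatTrans.mapHomologicalComplex α _).app P.complex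

/-- Map on values. -/
abbrev cxLift (F : C ⥤ D) [F.Additive] {X Y : C} {P : ProjectiveResolution X}
    {Q : ProjectiveResolution Y} (φ : P.complex ⟶ Q.complex) : cx F P ⟶ cx F Q :=
  (F.mapHomologicalComplex _).map φ

lemma SESProj.cxw (h : SESProj α β) {X : C} (P : ProjectiveResolution X) :
    cxMap α P ≫ cxMap β P = 0 := by
  ext i
  exact congr_app h.w (P.complex.X i)

lemma SESProj.sc_shortExact (h : SESProj α β) {X : C} (P : ProjectiveResolution X) :
    (ShortComplex.mk (cxMap α P) (cxMap β P) (h.cxw P)).ShortExact := by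
  apply HomologicalComplex.shortExact_of_degreewise_shortExact
  intro i
  exact h.ex (P.complex.X i)

/-- connecting map -/
def SESProj.dP (h : SESProj α β) {X : C} (P : ProjectiveResolution X) (n : ℕ) :
    (cx K P).homology (n + 1) ⟶ (cx F P).homology n :=
  (h.sc_shortExact P).δ (n + 1) n (by simp)

lemma SESProj.dP_nat (h : SESProj α β) {X Y : C} {P : ProjectiveResolution X}
    {Q : ProjectiveResolution Y} (φ : P.complex ⟶ Q.complex) (n : ℕ) :
    h.dP P n ≫ HomologicalComplex.homologyMap (cxLift F φ) n =
      HomologicalComplex.homologyMap (cxLift K φ) (n + 1) ≫ h.dP Q n :=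
  HomologicalComplex.HomologySequence.δ_naturality
    (S₁ := ShortComplex.mk (cxMap α P) (cxMap β P) (h.cxw P))
    (S₂ := ShortComplex.mk (cxMap α Q) (cxMap β Q) (h.cxw Q))
    { τ₁ := cxLift F φ
      τ₂ := cxLift G φ
      τ₃ := cxLift K φ } (h.sc_shortExact P) (h.sc_shortExact Q) (n + 1) n (by simp)

lemma SESProj.dP_comp (h : SESProj α β) {X : C} (P : ProjectiveResolution X) (n : ℕ) :
    h.dP P n ≫ HomologicalComplex.homologyMap (cxMap α P) n = 0 :=
  (h.sc_shortExact P).δ_comp (n + 1) n (by simp)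

lemma SESProj.comp_dP (h : SESProj α β) {X : C} (P : ProjectiveResolution X) (n : ℕ) :
    HomologicalComplex.homologyMap (cxMap β P) (n + 1) ≫ h.dP P n = 0 :=
  (h.sc_shortExact P).comp_δ (n + 1) n (by simp)

lemma SESProj.comp_comp (h : SESProj α β) {X : C} (P : ProjectiveResolution X) (n : ℕ) :
    HomologicalComplex.homologyMap (cxMap α P) n ≫
      HomologicalComplex.homologyMap (cxMap β P) n = 0 := by
  rw [← HomologicalComplex.homologyMap_comp, h.cxw, HomologicalComplex.homologyMap_zero]

variable [EnoughProjectives C]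

/-- Left derived functors computed by the chosen resolution. -/
def hl (F : C ⥤ D) [F.Additive] (n : ℕ) (X : C) :
    (F.leftDerived n).obj X ≅ (cx F (projectiveResolution X)).homology n :=
  (projectiveResolution X).isoLeftDerivedObj F n

lemma hl_nat (F : C ⥤ D) [F.Additive] (n : ℕ) {X Y : C} (f : X ⟶ Y)
    (φ : (projectiveResolution X).complex ⟶ (projectiveResolution Y).complex)
    (comm : φ.f 0 ≫ (projectiveResolution Y).π.f 0 = (projectiveResolution X).π.f 0 ≫ f) :
    (F.leftDerived n).map f ≫ (hl F n Y).hom =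
      (hl F n X).hom ≫ HomologicalComplex.homologyMap (cxLift F φ) n :=
  ProjectiveResolution.isoLeftDerivedObj_hom_naturality f _ _ φ comm F n

lemma hl_app (α : F ⟶ G) (n : ℕ) (X : C) :
    (NatTrans.leftDerived α n).app X = (hl F n X).hom ≫
      HomologicalComplex.homologyMap (cxMap α (projectiveResolution X)) n ≫ (hl G n X).inv :=
  ProjectiveResolution.leftDerived_app_eq α (projectiveResolution X) n

/-- connecting map of left derived functors -/
def SESProj.δ (h : SESProj α β) (n : ℕ) : K.leftDerived (n + 1) ⟶ F.leftDerived n where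
  app X := (hl K (n + 1) X).hom ≫ h.dP _ n ≫ (hl F n X).inv
  naturality X Y f := by
    have comm : (ProjectiveResolution.lift f (projectiveResolution X)
      (projectiveResolution Y)).f 0 ≫ (projectiveResolution Y).π.f 0 =
        (projectiveResolution X).π.f 0 ≫ f := ProjectiveResolution.lift_commutes_zero f _ _
    rw [← cancel_mono (hl F n Y).hom]
    simp only [Category.assoc, Iso.inv_hom_id, Category.comp_id]
    rw [hl_nat F n f _ comm, Iso.inv_hom_id_assoc, h.dP_nat, ← Category.assoc, hl_nat K (n+1) f _ comm,
      Category.assoc]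

lemma SESProj.zero₂ (h : SESProj α β) (n : ℕ) (X : C) :
   (NatTrans.leftDerived α n).app X ≫ (NatTrans.leftDerived β n).app X = 0 := by
  have := h.comp_comp (projectiveResolution X) n
  simp [hl_app, reassoc_of% this]

lemma SESProj.exact₂ (h : SESProj α β) (n : ℕ) (X : C) :
   (ShortComplex.mk ((NatTrans.leftDerived α n).app X) ((NatTrans.leftDerived β n).app X)
    (h.zero₂ n X)).Exact := by
  have : (ShortComplex.mk _ _ (h.comp_comp (projectiveResolution X) n)).Exact :=
    (h.sc_shortExact (projectiveResolution X)).homology_exact₂ n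
  refine ShortComplex.exact_of_iso ?_ this
  exact ShortComplex.isoMk (hl F n X).symm (hl G n X).symm (hl K n X).symm
    (by simp [hl_app]) (by simp [hl_app])

lemma SESProj.zero₁ (h : SESProj α β) (n : ℕ) (X : C) :
   (h.δ n).app X ≫ (NatTrans.leftDerived α n).app X = 0 := by
  have := h.dP_comp (projectiveResolution X) n
  simp [hl_app, SESProj.δ, reassoc_of% this]

lemma SESProj.zero₃ (h : SESProj α β) (n : ℕ) (X : C) :
   (NatTrans.leftDerived β (n+1)).app X ≫ (h.δ n).app X = 0 := by
  have := h.comp_dP (projectiveResolution X) n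
  simp [hl_app, SESProj.δ, reassoc_of% this]

lemma SESProj.exact₁ (h : SESProj α β) (n : ℕ) (X : C) :
   (ShortComplex.mk ((h.δ n).app X) ((NatTrans.leftDerived α n).app X)
    (h.zero₁ n X)).Exact := by
  have : (ShortComplex.mk _ _ (h.dP_comp (projectiveResolution X) n)).Exact :=
    (h.sc_shortExact (projectiveResolution X)).homology_exact₁ (n+1) n (by simp)
  refine ShortComplex.exact_of_iso ?_ this
  exact ShortComplex.isoMk (hl K (n+1) X).symm (hl F n X).symm (hl G n X).symm
    (by simp [SESProj.δ]) (by simp [hl_app])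

lemma SESProj.exact₃ (h : SESProj α β) (n : ℕ) (X : C) :
   (ShortComplex.mk ((NatTrans.leftDerived β (n+1)).app X) ((h.δ n).app X)
    (h.zero₃ n X)).Exact := by
  have : (ShortComplex.mk _ _ (h.comp_dP (projectiveResolution X) n)).Exact :=
    (h.sc_shortExact (projectiveResolution X)).homology_exact₃ (n+1) n (by simp)
  refine ShortComplex.exact_of_iso ?_ this
  exact ShortComplex.isoMk (hl G (n+1) X).symm (hl K (n+1) X).symm (hl F n X).symm
    (by simp [hl_app]) (by simp [SESProj.δ])

/-- A natural endomorphism of the identity functor passes to homology. -/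
lemma homology_endo (η : 𝟭 D ⟶ 𝟭 D) (L : ChainComplex D ℕ) (φ : L ⟶ L)
    (hφ : ∀ i, φ.f i = η.app (L.X i)) (n : ℕ) :
    HomologicalComplex.homologyMap φ n = η.app (L.homology n) := by
  have h1 : HomologicalComplex.cyclesMap φ n = η.app (L.cycles n) := by
    rw [← cancel_mono (L.iCycles n), HomologicalComplex.cyclesMap_i, hφ]
    exact (η.naturality (L.iCycles n))
  rw [← cancel_epi (L.homologyπ n), HomologicalComplex.homologyπ_naturality, h1]
  exact (η.naturality (L.homologyπ n)).symm

lemma leftDerived_app_endo (η : 𝟭 D ⟶ 𝟭 D) (φ : F ⟶ F)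
    (hφ : ∀ X, φ.app X = η.app (F.obj X)) (n : ℕ) (X : C) :
    (NatTrans.leftDerived φ n).app X = η.app ((F.leftDerived n).obj X) := by
  rw [hl_app, homology_endo η _ _ (fun i => hφ _)]
  rw [← Category.assoc, Iso.comp_inv_eq]
  exact (η.naturality (hl F n X).hom)

lemma leftDerived_map_endo (η : 𝟭 D ⟶ 𝟭 D) (θ : 𝟭 C ⟶ 𝟭 C)
    (hφ : ∀ X, F.map (θ.app X) = η.app (F.obj X)) (n : ℕ) (X : C) :
    (F.leftDerived n).map (θ.app X) = η.app ((F.leftDerived n).obj X) := by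
  let φ : (projectiveResolution X).complex ⟶ (projectiveResolution X).complex :=
    { f := fun i => θ.app _
      comm' := fun i j _ => (θ.naturality _).symm }
  have := hl_nat F n (θ.app X) φ (θ.naturality _).symm
  rw [← cancel_mono (hl F n X).hom]
  refine this.trans ?_
  rw [homology_endo η _ _ (fun i => hφ _)]
  exact (η.naturality (hl F n X).hom)

/-- Naturality in the functor of the comparison in degree zero. -/
lemma fromLeftDerivedZero_nat (α : F ⟶ G) (X : C) :
    (NatTrans.leftDerived α 0).app X ≫ G.fromLeftDerivedZero.app X =
      F.fromLeftDerivedZero.app X ≫ α.app X := by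
  have hF : F.fromLeftDerivedZero.app X = (hl F 0 X).hom ≫ HomologicalComplex.homologyι _ _ ≫
    (projectiveResolution X).fromLeftDerivedZero' F :=
    (projectiveResolution X).fromLeftDerivedZero_eq F
  have hG : G.fromLeftDerivedZero.app X = (hl G 0 X).hom ≫ HomologicalComplex.homologyι _ _ ≫
    (projectiveResolution X).fromLeftDerivedZero' G :=
    (projectiveResolution X).fromLeftDerivedZero_eq G
  rw [hF, hG, hl_app]
  simp only [Category.assoc, Iso.inv_hom_id_assoc, HomologicalComplex.homologyι_naturality_assoc]
  congr 2
  rw [← cancel_epi (HomologicalComplex.pOpcycles _ _)]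
  rw [HomologicalComplex.p_opcyclesMap_assoc,
    ProjectiveResolution.pOpcycles_comp_fromLeftDerivedZero',
    ProjectiveResolution.pOpcycles_comp_fromLeftDerivedZero'_assoc]
  exact (α.naturality _).symm

end LeftDerived

section ExtAPI
variable {R : Type} [CommRing R]

/-- The contravariant functor `Hom(-, Y)`. -/
abbrev homF (Y : ModuleCat.{0} R) : ModuleCat.{0} R ⥤ (ModuleCat.{0} R)ᵒᵖ :=
  ((linearYoneda R (ModuleCat.{0} R)).obj Y).rightOp

/-- Its functoriality. -/
abbrev homFMap {Y Z : ModuleCat.{0} R} (f : Y ⟶ Z) : homF Z ⟶ homF Y :=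
  NatTrans.rightOp ((linearYoneda R (ModuleCat.{0} R)).map f)

lemma homF_ses {S : ShortComplex (ModuleCat.{0} R)} (hS : S.ShortExact) :
    SESProj (homFMap S.g) (homFMap S.f) where
  w := by
    ext X
    apply Quiver.Hom.unop_inj
    ext (x : X ⟶ S.X₁)
    change (x ≫ S.f) ≫ S.g = 0
    rw [Category.assoc, S.zero, comp_zero]
  ex P hP := by
    have hm : Mono S.f := hS.mono_f
    have he : Epi S.g := hS.epi_g
    let T : ShortComplex (ModuleCat.{0} R) := ShortComplex.mk
      (((linearYoneda R (ModuleCat.{0} R)).map S.f).app (op P))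
      (((linearYoneda R (ModuleCat.{0} R)).map S.g).app (op P)) (by
        ext (x : P ⟶ S.X₁)
        change (x ≫ S.f) ≫ S.g = 0
        rw [Category.assoc, S.zero, comp_zero])
    have hT : T.ShortExact := by
      refine ShortComplex.ShortExact.mk' ?_ ?_ ?_
      · rw [ShortComplex.moduleCat_exact_iff]
        intro (x : P ⟶ S.X₂) (hx : x ≫ S.g = 0)
        exact ⟨hS.exact.lift x hx, hS.exact.lift_f x hx⟩
      · rw [ModuleCat.mono_iff_injective]
        intro (x : P ⟶ S.X₁) (y : P ⟶ S.X₁) (hxy : x ≫ S.f = y ≫ S.f)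
        exact (cancel_mono S.f).1 hxy
      · rw [ModuleCat.epi_iff_surjective]
        intro (x : P ⟶ S.X₃)
        exact ⟨Projective.factorThru x S.g, Projective.factorThru_comp x S.g⟩
    exact hT.op

/-- `Ext`. -/
abbrev E (i : ℕ) (X Y : ModuleCat.{0} R) : ModuleCat.{0} R :=
  ((Ext R (ModuleCat.{0} R) i).obj (op X)).obj Y

/-- functoriality in the second variable -/
abbrev Emap (i : ℕ) (X : ModuleCat.{0} R) {Y Z : ModuleCat.{0} R} (f : Y ⟶ Z) : E i X Y ⟶ E i X Z :=
  ((Ext R (ModuleCat.{0} R) i).obj (op X)).map f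

/-- functoriality in the first variable -/
abbrev Epre (i : ℕ) {X X' : ModuleCat.{0} R} (g : X' ⟶ X) (Y : ModuleCat.{0} R) : E i X Y ⟶ E i X' Y :=
  ((Ext R (ModuleCat.{0} R) i).map g.op).app Y

lemma Epre_Emap (i : ℕ) {X X' : ModuleCat.{0} R} (g : X' ⟶ X) {Y Z : ModuleCat.{0} R} (f : Y ⟶ Z) :
    Epre i g Y ≫ Emap i X' f = Emap i X f ≫ Epre i g Z :=
  (((Ext R (ModuleCat.{0} R) i).map g.op).naturality f).symm

/-- connecting homomorphism -/
def Eδ {S : ShortComplex (ModuleCat.{0} R)} (hS : S.ShortExact) (i : ℕ) (X : ModuleCat.{0} R) :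
    E i X S.X₃ ⟶ E (i + 1) X S.X₁ :=
  (((homF_ses hS).δ i).app X).unop

lemma Epre_Eδ {S : ShortComplex (ModuleCat.{0} R)} (hS : S.ShortExact) (i : ℕ)
    {X X' : ModuleCat.{0} R} (g : X' ⟶ X) :
    Epre i g S.X₃ ≫ Eδ hS i X' = Eδ hS i X ≫ Epre (i + 1) g S.X₁ :=
  congrArg Quiver.Hom.unop (((homF_ses hS).δ i).naturality g).symm

lemma E_exact₂ {S : ShortComplex (ModuleCat.{0} R)} (hS : S.ShortExact) (i : ℕ)
    (X : ModuleCat.{0} R) : Function.Exact (Emap i X S.f) (Emap i X S.g) :=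
  (ShortComplex.ShortExact.moduleCat_exact_iff_function_exact _).1 ((homF_ses hS).exact₂ i X).unop

lemma E_exact₃ {S : ShortComplex (ModuleCat.{0} R)} (hS : S.ShortExact) (i : ℕ)
    (X : ModuleCat.{0} R) : Function.Exact (Emap i X S.g) (Eδ hS i X) :=
  (ShortComplex.ShortExact.moduleCat_exact_iff_function_exact _).1 ((homF_ses hS).exact₁ i X).unop

lemma E_exact₁ {S : ShortComplex (ModuleCat.{0} R)} (hS : S.ShortExact) (i : ℕ)
    (X : ModuleCat.{0} R) : Function.Exact (Eδ hS i X) (Emap (i + 1) X S.f) :=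
  (ShortComplex.ShortExact.moduleCat_exact_iff_function_exact _).1 ((homF_ses hS).exact₃ i X).unop

/-- multiplication by a scalar -/
def smulId (a : R) : 𝟭 (ModuleCat.{0} R) ⟶ 𝟭 (ModuleCat.{0} R) where
  app Z := a • 𝟙 Z

/-- multiplication by a scalar, opposite category -/
def smulIdOp (a : R) : 𝟭 (ModuleCat.{0} R)ᵒᵖ ⟶ 𝟭 (ModuleCat.{0} R)ᵒᵖ where
  app Z := (a • 𝟙 Z.unop).op
  naturality X Y f := by
    apply Quiver.Hom.unop_inj
    simp

lemma Emap_smul (a : R) (i : ℕ) (X Y : ModuleCat.{0} R) (x : E i X Y) :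
    Emap i X (a • 𝟙 Y) x = a • x := by
  have := leftDerived_app_endo (smulIdOp a) (homFMap (a • 𝟙 Y)) (fun X => by
    apply Quiver.Hom.unop_inj
    ext (x : X ⟶ Y)
    change x ≫ (a • 𝟙 Y) = a • x
    simp) i X
  have h2 := congrArg Quiver.Hom.unop this
  exact congrArg (fun t : E i X Y ⟶ E i X Y => t x) h2

lemma Epre_smul (a : R) (i : ℕ) (X Y : ModuleCat.{0} R) (x : E i X Y) :
    Epre i (a • 𝟙 X) Y x = a • x := by
  have := leftDerived_map_endo (F := homF Y) (smulIdOp a) (smulId a) (fun X => by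
    apply Quiver.Hom.unop_inj
    ext (x : X ⟶ Y)
    change (a • 𝟙 X) ≫ x = a • x
    simp) i X
  have h2 := congrArg Quiver.Hom.unop this
  exact congrArg (fun t : E i X Y ⟶ E i X Y => t x) h2

instance (Y : ModuleCat.{0} R) : PreservesFiniteColimits (homF Y) :=
  have : PreservesLimits ((linearYoneda R (ModuleCat.{0} R)).obj Y ⋙ forget _) :=
    (inferInstance : PreservesLimits (yoneda.obj Y))
  have : PreservesLimits ((linearYoneda R (ModuleCat.{0} R)).obj Y) :=
    preservesLimits_of_reflects_of_preserves _ (forget _)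
  preservesFiniteColimits_rightOp _

/-- degree zero -/
def E0 (X Y : ModuleCat.{0} R) : ModuleCat.of R (X ⟶ Y) ≅ E 0 X Y :=
  (asIso ((homF Y).fromLeftDerivedZero.app X)).unop

lemma E0_Emap (X : ModuleCat.{0} R) {Y Z : ModuleCat.{0} R} (f : Y ⟶ Z) (x : X ⟶ Y) :
    Emap 0 X f ((E0 X Y).hom x) = (E0 X Z).hom (x ≫ f) := by
  have := fromLeftDerivedZero_nat (homFMap f) X
  have h2 := congrArg Quiver.Hom.unop this
  exact congrArg (fun t : ModuleCat.of R (X ⟶ Y) ⟶ E 0 X Z => t x) h2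

lemma E0_Epre {X X' : ModuleCat.{0} R} (g : X' ⟶ X) (Y : ModuleCat.{0} R) (x : X ⟶ Y) :
    Epre 0 g Y ((E0 X Y).hom x) = (E0 X' Y).hom (g ≫ x) := by
  have := (homF Y).fromLeftDerivedZero.naturality g
  have h2 := congrArg Quiver.Hom.unop this
  exact congrArg (fun t : ModuleCat.of R (X ⟶ Y) ⟶ E 0 X' Y => t x) h2

lemma E_injective (i : ℕ) (X I : ModuleCat.{0} R) [Injective I] (x : E (i + 1) X I) : x = 0 := by
  suffices h : IsZero (E (i + 1) X I) by
    have := ModuleCat.subsingleton_of_isZero h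
    exact Subsingleton.elim _ _
  let P := projectiveResolution X
  refine IsZero.of_iso ?_ (P.isoExt (i + 1) I)
  rw [← HomologicalComplex.exactAt_iff_isZero_homology,
    HomologicalComplex.exactAt_iff' _ i (i+1) (i+2) (by simp) (by simp),
    ShortComplex.moduleCat_exact_iff]
  intro (z : P.complex.X (i+1) ⟶ I) (hz : P.complex.d (i+2) (i+1) ≫ z = 0)
  have ex := P.exact_succ i
  exact ⟨ex.descToInjective z hz, ex.comp_descToInjective z hz⟩

end ExtAPI

section LC
variable {R : Type} [CommRing R] (𝔞 : Ideal R)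

/-- local cohomology module -/
abbrev H (i : ℕ) (N : ModuleCat.{0} R) : ModuleCat.{0} R := (localCohomology 𝔞 i).obj N

/-- functoriality -/
abbrev Hmap (i : ℕ) {N N' : ModuleCat.{0} R} (f : N ⟶ N') : H 𝔞 i N ⟶ H 𝔞 i N' :=
  (localCohomology 𝔞 i).map f

/-- `R / 𝔞 ^ n` -/
abbrev Rn (n : ℕ) : ModuleCat.{0} R := ModuleCat.of R (R ⧸ 𝔞 ^ n)

/-- transition maps -/
abbrev tr {n m : ℕ} (h : n ≤ m) : Rn 𝔞 m ⟶ Rn 𝔞 n :=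
  ModuleCat.ofHom (Submodule.mapQ _ _ LinearMap.id (Ideal.pow_le_pow_right h))

/-- the diagram -/
abbrev dg (i : ℕ) : ℕᵒᵖᵒᵖ ⥤ ModuleCat.{0} R ⥤ ModuleCat.{0} R :=
  localCohomology.diagram (localCohomology.idealPowersDiagram 𝔞) i

/-- the colimit cocone evaluated -/
abbrev cc (i : ℕ) (N : ModuleCat.{0} R) : Cocone (dg 𝔞 i ⋙ (evaluation _ _).obj N) :=
  ((evaluation _ _).obj N).mapCocone (colimit.cocone (dg 𝔞 i))

/-- it is a colimit -/
def ccIs (i : ℕ) (N : ModuleCat.{0} R) : IsColimit (cc 𝔞 i N) :=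
  isColimitOfPreserves ((evaluation _ _).obj N) (colimit.isColimit (dg 𝔞 i))

/-- structure map -/
def ι (i n : ℕ) (N : ModuleCat.{0} R) : E i (Rn 𝔞 n) N ⟶ H 𝔞 i N :=
  (cc 𝔞 i N).ι.app (op (op n))

lemma ι_tr (i : ℕ) {n m : ℕ} (h : n ≤ m) (N : ModuleCat.{0} R) (e : E i (Rn 𝔞 n) N) :
    ι 𝔞 i m N (Epre i (tr 𝔞 h) N e) = ι 𝔞 i n N e :=
  congrArg (fun t : E i (Rn 𝔞 n) N ⟶ H 𝔞 i N => t e)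
    ((cc 𝔞 i N).w (j' := op (op n)) (j := op (op m)) (homOfLE h).op.op)

lemma ι_map (i n : ℕ) {N N' : ModuleCat.{0} R} (f : N ⟶ N') (e : E i (Rn 𝔞 n) N) :
    Hmap 𝔞 i f (ι 𝔞 i n N e) = ι 𝔞 i n N' (Emap i _ f e) :=
  congrArg (fun t : E i (Rn 𝔞 n) N ⟶ H 𝔞 i N' => t e)
    ((colimit.ι (dg 𝔞 i) (op (op n))).naturality f).symm

lemma exists_rep (i : ℕ) (N : ModuleCat.{0} R) (x : H 𝔞 i N) :
    ∃ n e, ι 𝔞 i n N e = x := by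
  obtain ⟨j, e, h⟩ := Concrete.isColimit_exists_rep _ (ccIs 𝔞 i N) x
  exact ⟨j.unop.unop, e, h⟩

lemma ι_eq_zero (i n : ℕ) (N : ModuleCat.{0} R) (e : E i (Rn 𝔞 n) N) (h : ι 𝔞 i n N e = 0) :
    ∃ (m : ℕ) (h : n ≤ m), Epre i (tr 𝔞 h) N e = 0 := by
  obtain ⟨k, f, g, hh⟩ := Concrete.isColimit_exists_of_rep_eq (dg 𝔞 i ⋙ (evaluation _ _).obj N)
    (ccIs 𝔞 i N)
    (i := op (op n)) (j := op (op n)) e 0 (h.trans (map_zero (ι 𝔞 i n N).hom).symm)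
  refine ⟨k.unop.unop, leOfHom f.unop.unop, ?_⟩
  exact hh.trans (map_zero (ModuleCat.Hom.hom _))

/-- connecting homomorphism -/
def Hδ {S : ShortComplex (ModuleCat.{0} R)} (hS : S.ShortExact) (i : ℕ) :
    H 𝔞 i S.X₃ ⟶ H 𝔞 (i + 1) S.X₁ :=
  (ccIs 𝔞 i S.X₃).desc ⟨H 𝔞 (i + 1) S.X₁,
    { app := fun j => Eδ hS i (Rn 𝔞 j.unop.unop) ≫ ι 𝔞 (i + 1) j.unop.unop S.X₁
      naturality := fun j k f => by
        ext e
        have h : j.unop.unop ≤ k.unop.unop := leOfHom f.unop.unop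
        have h1 := congrArg (fun t => t e) (Epre_Eδ hS i (tr 𝔞 h))
        have h2 := ι_tr 𝔞 (i+1) h S.X₁ (Eδ hS i _ e)
        refine Eq.trans ?_ h2
        exact congrArg (ι 𝔞 (i+1) _ S.X₁) h1 }⟩

lemma ι_δ {S : ShortComplex (ModuleCat.{0} R)} (hS : S.ShortExact) (i n : ℕ)
    (e : E i (Rn 𝔞 n) S.X₃) :
    Hδ 𝔞 hS i (ι 𝔞 i n _ e) = ι 𝔞 (i + 1) n _ (Eδ hS i _ e) :=
  congrArg (fun t : E i (Rn 𝔞 n) S.X₃ ⟶ _ => t e) ((ccIs 𝔞 i S.X₃).fac _ (op (op n)))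

lemma Epre_Emap' (i : ℕ) {X X' : ModuleCat.{0} R} (g : X' ⟶ X) {Y Z : ModuleCat.{0} R} (f : Y ⟶ Z)
    (e : E i X Y) : Emap i X' f (Epre i g Y e) = Epre i g Z (Emap i X f e) :=
  congrArg (fun t => t e) (Epre_Emap i g f)

lemma Epre_Eδ' {S : ShortComplex (ModuleCat.{0} R)} (hS : S.ShortExact) (i : ℕ)
    {X X' : ModuleCat.{0} R} (g : X' ⟶ X) (e : E i X S.X₃) :
    Eδ hS i X' (Epre i g S.X₃ e) = Epre (i + 1) g S.X₁ (Eδ hS i X e) :=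
  congrArg (fun t => t e) (Epre_Eδ hS i g)

lemma ι_zero (i n : ℕ) (N : ModuleCat.{0} R) : ι 𝔞 i n N 0 = 0 := map_zero (ι 𝔞 i n N).hom

lemma H_exact₂ {S : ShortComplex (ModuleCat.{0} R)} (hS : S.ShortExact) (i : ℕ) :
    Function.Exact (Hmap 𝔞 i S.f) (Hmap 𝔞 i S.g) := by
  intro y
  constructor
  · intro hy
    obtain ⟨n, e, rfl⟩ := exists_rep 𝔞 i _ y
    rw [ι_map] at hy
    obtain ⟨m, h, hm⟩ := ι_eq_zero 𝔞 i n _ _ hy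
    rw [← Epre_Emap'] at hm
    obtain ⟨e', he'⟩ := (E_exact₂ hS i _ _).1 hm
    exact ⟨ι 𝔞 i m _ e', by rw [ι_map, he', ι_tr]⟩
  · rintro ⟨x, rfl⟩
    obtain ⟨n, e, rfl⟩ := exists_rep 𝔞 i _ x
    rw [ι_map, ι_map, (E_exact₂ hS i _ _).2 ⟨e, rfl⟩, ι_zero]

lemma H_exact₃ {S : ShortComplex (ModuleCat.{0} R)} (hS : S.ShortExact) (i : ℕ) :
    Function.Exact (Hmap 𝔞 i S.g) (Hδ 𝔞 hS i) := by
  intro y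
  constructor
  · intro hy
    obtain ⟨n, e, rfl⟩ := exists_rep 𝔞 i _ y
    rw [ι_δ] at hy
    obtain ⟨m, h, hm⟩ := ι_eq_zero 𝔞 (i+1) n _ _ hy
    rw [← Epre_Eδ'] at hm
    obtain ⟨e', he'⟩ := (E_exact₃ hS i _ _).1 hm
    exact ⟨ι 𝔞 i m _ e', by rw [ι_map, he', ι_tr]⟩
  · rintro ⟨x, rfl⟩
    obtain ⟨n, e, rfl⟩ := exists_rep 𝔞 i _ x
    rw [ι_map, ι_δ, (E_exact₃ hS i _ _).2 ⟨e, rfl⟩, ι_zero]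

lemma H_exact₁ {S : ShortComplex (ModuleCat.{0} R)} (hS : S.ShortExact) (i : ℕ) :
    Function.Exact (Hδ 𝔞 hS i) (Hmap 𝔞 (i+1) S.f) := by
  intro y
  constructor
  · intro hy
    obtain ⟨n, e, rfl⟩ := exists_rep 𝔞 (i+1) _ y
    rw [ι_map] at hy
    obtain ⟨m, h, hm⟩ := ι_eq_zero 𝔞 (i+1) n _ _ hy
    rw [← Epre_Emap'] at hm
    obtain ⟨e', he'⟩ := (E_exact₁ hS i _ _).1 hm
    exact ⟨ι 𝔞 i m _ e', by rw [ι_δ, he', ι_tr]⟩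
  · rintro ⟨x, rfl⟩
    obtain ⟨n, e, rfl⟩ := exists_rep 𝔞 i _ x
    rw [ι_δ, ι_map, (E_exact₁ hS i _ _).2 ⟨e, rfl⟩, ι_zero]

lemma Hmap_smul (a : R) (i : ℕ) (N : ModuleCat.{0} R) (x : H 𝔞 i N) :
    Hmap 𝔞 i (a • 𝟙 N) x = a • x := by
  obtain ⟨n, e, rfl⟩ := exists_rep 𝔞 i _ x
  rw [ι_map, Emap_smul]
  exact map_smul (ι 𝔞 i n N).hom a e

lemma H_torsion (i : ℕ) (N : ModuleCat.{0} R) (x : H 𝔞 i N) :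
    ∃ n, ∀ a ∈ 𝔞 ^ n, a • x = 0 := by
  obtain ⟨n, e, rfl⟩ := exists_rep 𝔞 i _ x
  refine ⟨n, fun a ha => ?_⟩
  have h0 : a • 𝟙 (Rn 𝔞 n) = 0 • 𝟙 (Rn 𝔞 n) := by
    rw [zero_smul]
    ext : 1
    refine Submodule.linearMap_qext _ ?_
    ext
    change a • (Ideal.Quotient.mk (𝔞 ^ n) 1) = 0
    rw [← Ideal.Quotient.mk_eq_mk, ← Submodule.Quotient.mk_smul, Submodule.Quotient.mk_eq_zero]
    simpa using ha
  have h1 := Epre_smul a i (Rn 𝔞 n) N e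
  have h2 := Epre_smul 0 i (Rn 𝔞 n) N e
  rw [zero_smul] at h2 h0
  have h3 : a • e = 0 := by
    rw [← h1, h0, ← zero_smul R (𝟙 (Rn 𝔞 n)), Epre_smul, zero_smul]
  exact (map_smul (ι 𝔞 i n N).hom a e).symm.trans ((congrArg _ h3).trans (ι_zero ..))

lemma H_injective (i : ℕ) (I : ModuleCat.{0} R) [Injective I] (x : H 𝔞 (i+1) I) : x = 0 := by
  obtain ⟨n, e, rfl⟩ := exists_rep 𝔞 _ _ x
  rw [E_injective i _ I e, ι_zero]

/-- representatives in degree zero -/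
lemma H0_rep (N : ModuleCat.{0} R) (x : H 𝔞 0 N) :
    ∃ n, ∃ φ : Rn 𝔞 n ⟶ N, ι 𝔞 0 n N ((E0 _ N).hom φ) = x := by
  obtain ⟨n, e, rfl⟩ := exists_rep 𝔞 _ _ x
  refine ⟨n, (E0 _ N).inv e, ?_⟩
  exact congrArg (ι 𝔞 0 n N) (congrArg (fun t : E 0 (Rn 𝔞 n) N ⟶ _ => t e) (E0 _ N).inv_hom_id)

/-- the map `R / 𝔞 ^ n → N` given by an element -/
def elHom (N : ModuleCat.{0} R) (n : ℕ) (q : N) (hq : ∀ a ∈ 𝔞 ^ n, a • q = 0) : Rn 𝔞 n ⟶ N :=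
  ModuleCat.ofHom (Submodule.liftQ _ (LinearMap.toSpanSingleton R N q) (fun a ha => hq a ha))

/-- the element of `H^0` given by a torsion element -/
def el (N : ModuleCat.{0} R) (n : ℕ) (q : N) (hq : ∀ a ∈ 𝔞 ^ n, a • q = 0) : H 𝔞 0 N :=
  ι 𝔞 0 n N ((E0 _ N).hom (elHom 𝔞 N n q hq))

lemma el_le (N : ModuleCat.{0} R) {n m : ℕ} (h : n ≤ m) (q : N) (hq : ∀ a ∈ 𝔞 ^ n, a • q = 0)
    (hq' : ∀ a ∈ 𝔞 ^ m, a • q = 0) : el 𝔞 N m q hq' = el 𝔞 N n q hq := by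
  unfold el
  rw [← ι_tr 𝔞 0 h, E0_Epre]
  congr 2
  ext : 1
  refine Submodule.linearMap_qext _ ?_
  ext
  rfl

lemma el_indep (N : ModuleCat.{0} R) {n m : ℕ} (q : N) (hq : ∀ a ∈ 𝔞 ^ n, a • q = 0)
    (hq' : ∀ a ∈ 𝔞 ^ m, a • q = 0) : el 𝔞 N m q hq' = el 𝔞 N n q hq := by
  rcases le_total n m with h | h
  · exact el_le 𝔞 N h q hq hq'
  · exact (el_le 𝔞 N h q hq' hq).symm

lemma el_rep (N : ModuleCat.{0} R) (x : H 𝔞 0 N) : ∃ n q hq, el 𝔞 N n q hq = x := by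
  obtain ⟨n, φ, rfl⟩ := H0_rep 𝔞 N x
  refine ⟨n, φ (Submodule.Quotient.mk 1), fun a ha => ?_, ?_⟩
  · rw [← map_smul φ.hom, ← Submodule.Quotient.mk_smul,
      (Submodule.Quotient.mk_eq_zero (𝔞 ^ n)).2 (by simpa using ha)]
    exact map_zero φ.hom
  · unfold el
    congr 2
    ext : 1
    refine Submodule.linearMap_qext _ ?_
    ext
    change (1 : R) • φ (Submodule.Quotient.mk 1) = φ (Submodule.Quotient.mk 1)
    rw [one_smul]

lemma Hmap_el {N N' : ModuleCat.{0} R} (f : N ⟶ N') (n : ℕ) (q : N)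
    (hq : ∀ a ∈ 𝔞 ^ n, a • q = 0) (hq' : ∀ a ∈ 𝔞 ^ n, a • f q = 0) :
    Hmap 𝔞 0 f (el 𝔞 N n q hq) = el 𝔞 N' n (f q) hq' := by
  unfold el
  rw [ι_map, E0_Emap]
  congr 2
  ext : 1
  refine Submodule.linearMap_qext _ ?_
  ext
  change f ((1 : R) • q) = (1 : R) • f q
  rw [one_smul, one_smul]

lemma el_surj (N : ModuleCat.{0} R) (k : ℕ)
    (hk : ∀ (n : ℕ) (q : N), (∀ a ∈ 𝔞 ^ n, a • q = 0) → ∀ a ∈ 𝔞 ^ k, a • q = 0) :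
    Function.Surjective ((E0 (Rn 𝔞 k) N).hom ≫ ι 𝔞 0 k N) := by
  intro x
  obtain ⟨n, q, hq, rfl⟩ := el_rep 𝔞 N x
  exact ⟨elHom 𝔞 N k q (hk n q hq), el_indep 𝔞 N q hq (hk n q hq)⟩

end LC

section Alg
variable {R : Type} [CommRing R] (𝔞 : Ideal R)

/-- elements killed by `𝔞 ^ n` -/
def GamN (n : ℕ) (M : Type) [AddCommGroup M] [Module R M] : Submodule R M where
  carrier := {q | ∀ a ∈ 𝔞 ^ n, a • q = 0}
  add_mem' := fun hx hy a ha => by rw [smul_add, hx a ha, hy a ha, add_zero]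
  zero_mem' := fun a _ => smul_zero a
  smul_mem' := fun r x hx a ha => by rw [smul_comm, hx a ha, smul_zero]

lemma GamN_mono (M : Type) [AddCommGroup M] [Module R M] : Monotone (fun n => GamN 𝔞 n M) :=
  fun _ _ h _ hq a ha => hq a (Ideal.pow_le_pow_right h ha)

/-- torsion elements -/
def Gam (M : Type) [AddCommGroup M] [Module R M] : Submodule R M where
  carrier := {q | ∃ n, q ∈ GamN 𝔞 n M}
  add_mem' := by
    rintro x y ⟨n, hx⟩ ⟨m, hy⟩
    exact ⟨max n m, add_mem (GamN_mono 𝔞 M (le_max_left n m) hx)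
      (GamN_mono 𝔞 M (le_max_right n m) hy)⟩
  zero_mem' := ⟨0, zero_mem _⟩
  smul_mem' := fun r x ⟨n, hx⟩ => ⟨n, Submodule.smul_mem _ r hx⟩

lemma unif {M X : Type} [AddCommGroup M] [Module R M] [IsNoetherian R M]
    [AddCommGroup X] [Module R X] (g : M →ₗ[R] X) :
    ∃ k, ∀ n q, g q ∈ GamN 𝔞 n X → g q ∈ GamN 𝔞 k X := by
  obtain ⟨k, hk⟩ := monotone_stabilizes_iff_noetherian.2 ‹IsNoetherian R M›
    ⟨fun n => (GamN 𝔞 n X).comap g, fun _ _ h => Submodule.comap_mono (GamN_mono 𝔞 X h)⟩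
  refine ⟨k, fun n q hq => ?_⟩
  have h1 : q ∈ (GamN 𝔞 (max k n) X).comap g := GamN_mono 𝔞 X (le_max_right k n) hq
  have h2 : (GamN 𝔞 k X).comap g = (GamN 𝔞 (max k n) X).comap g := hk _ (le_max_left k n)
  rw [← h2] at h1
  exact h1

lemma mem_pow_of_pow_add {M : Type} [AddCommGroup M] [Module R M] (q : M) (n k : ℕ)
    (h : ∀ a ∈ 𝔞 ^ n, a • q ∈ GamN 𝔞 k M) : q ∈ GamN 𝔞 (k + n) M := by
  intro a ha
  rw [pow_add] at ha
  refine Submodule.mul_induction_on ha (fun b hb c hc => ?_) (fun x y hx hy => ?_)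
  · rw [mul_smul]; exact h c hc b hb
  · rw [add_smul, hx, hy, add_zero]

lemma Gam_quot {M : Type} [AddCommGroup M] [Module R M] [IsNoetherian R M] :
    Gam 𝔞 (M ⧸ Gam 𝔞 M) = ⊥ := by
  rw [eq_bot_iff]
  rintro q ⟨n, hq⟩
  obtain ⟨q, rfl⟩ := Submodule.Quotient.mk_surjective _ q
  obtain ⟨k, hk⟩ := unif 𝔞 (LinearMap.id : M →ₗ[R] M)
  refine (Submodule.Quotient.mk_eq_zero _).2 ⟨k + n, mem_pow_of_pow_add 𝔞 q n k fun a ha => ?_⟩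
  have := hq a ha
  rw [← Submodule.Quotient.mk_smul, Submodule.Quotient.mk_eq_zero] at this
  obtain ⟨m, hm⟩ := this
  exact hk m _ hm

lemma Gam_injective [IsNoetherianRing R] (I : Type) [AddCommGroup I] [Module R I]
    [Module.Injective R I] : Module.Injective R (Gam 𝔞 I) := by
  refine Module.Baer.injective fun J g => ?_
  let g' : J →ₗ[R] I := (Gam 𝔞 I).subtype ∘ₗ g
  obtain ⟨n, hn⟩ := unif 𝔞 g'
  have hn' : ∀ j, g' j ∈ GamN 𝔞 n I := fun j => by
    obtain ⟨m, hm⟩ := (g j).2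
    exact hn m j hm
  obtain ⟨k, hk⟩ := Ideal.exists_pow_inf_eq_pow_smul 𝔞 (J : Submodule R R)
  have h1 := hk (n + k) (Nat.le_add_left k n)
  have hle : ((𝔞 ^ (n + k) : Ideal R)) ⊓ J ≤ (𝔞 ^ n • J : Ideal R) := by
    have e : (𝔞 ^ (n + k) • ⊤ : Ideal R) = 𝔞 ^ (n + k) := by simp
    rw [e, Nat.add_sub_cancel] at h1
    rw [h1]
    exact Submodule.smul_mono le_rfl inf_le_right
  have hkill : (𝔞 ^ n • J : Ideal R) ≤ (LinearMap.ker g').map J.subtype := by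
    rw [Submodule.smul_le]
    intro a ha j hj
    refine ⟨a • ⟨j, hj⟩, ?_, rfl⟩
    have := hn' ⟨j, hj⟩ a ha
    rw [← map_smul] at this
    exact this
  let L : Submodule R J := Submodule.comap (Submodule.subtype J) (𝔞 ^ (n + k) : Ideal R)
  have hL : L ≤ LinearMap.ker g' := by
    intro j hj
    obtain ⟨j', h1, h2⟩ := hkill (hle ⟨hj, j.2⟩)
    rwa [Subtype.ext h2] at h1
  let f : (J ⧸ L) →ₗ[R] (R ⧸ 𝔞 ^ (n + k)) := Submodule.mapQ _ _ (Submodule.subtype J) le_rfl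
  have hf : Function.Injective f := by
    rw [← LinearMap.ker_eq_bot, Submodule.ker_mapQ]
    rw [eq_bot_iff]
    rintro _ ⟨y, hy, rfl⟩
    exact (Submodule.Quotient.mk_eq_zero L).2 hy
  obtain ⟨h, hh⟩ := Module.Injective.out f hf (L.liftQ g' hL)
  refine ⟨LinearMap.codRestrict _ (h ∘ₗ Submodule.mkQ _) fun r => ⟨n + k, fun a ha => ?_⟩,
    fun r hr => Subtype.ext (hh (Submodule.Quotient.mk ⟨r, hr⟩))⟩
  have : a • (Submodule.Quotient.mk r : R ⧸ 𝔞 ^ (n + k)) = 0 := by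
    rw [← Submodule.Quotient.mk_smul, Submodule.Quotient.mk_eq_zero]
    exact Ideal.mul_mem_right _ _ ha
  change a • h (Submodule.Quotient.mk r) = 0
  rw [← map_smul, this, map_zero]

lemma exists_reg [IsNoetherianRing R] (M : Type) [AddCommGroup M] [Module R M] [Module.Finite R M]
    (h : Gam 𝔞 M = ⊥) : ∃ x ∈ 𝔞, IsSMulRegular M x := by
  by_contra! hcon
  have h1 : (𝔞 : Set R) ⊆ ⋃ p ∈ associatedPrimes R M, (p : Set R) := by
    have := biUnion_associatedPrimes_eq_compl_regular R M
    rw [this]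
    exact fun x hx => hcon x hx
  replace h1 := (Ideal.subset_union_prime_finite (associatedPrimes.finite R M) (f := id) ⊤ ⊤
    (fun i hi _ _ => hi.toIsPrime)).1 h1
  obtain ⟨p, hp, hle⟩ := h1
  obtain ⟨hpp, q, hq⟩ := Submodule.isAssociatedPrime_iff.1 hp
  have hq0 : q ∈ Gam 𝔞 M := ⟨1, fun a ha => by
    rw [pow_one] at ha
    have := hle ha
    rw [id, hq, Submodule.mem_colon_singleton] at this
    exact this⟩
  rw [h] at hq0
  refine hpp.ne_top ?_
  rw [hq, (Submodule.mem_bot R).1 hq0, Ideal.eq_top_iff_one, Submodule.mem_colon_singleton]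
  simp

lemma artin_of_prime [IsNoetherianRing R] (N : Type) [AddCommGroup N] [Module R N]
    [Module.Finite R N] (J : Ideal R) (hJ : ∀ a ∈ J, ∀ x : N, a • x = 0)
    (hp : ∀ p : Ideal R, p.IsPrime → J ≤ p → p.IsMaximal) : IsArtinian R N := by
  have ha : IsArtinianRing (R ⧸ J) := by
    rw [isArtinianRing_iff_isNoetherianRing_krullDimLE_zero]
    refine ⟨inferInstance, Ring.krullDimLE_zero_iff.2 fun p hpp => ?_⟩
    have := hp (p.comap (Ideal.Quotient.mk J)) inferInstance (fun x hx => by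
      rw [Ideal.mem_comap, Ideal.Quotient.eq_zero_iff_mem.2 hx]; exact zero_mem _)
    exact Ideal.isMaximal_of_isIntegral_of_isMaximal_comap' _
      (RingHom.isIntegral_of_surjective _ Ideal.Quotient.mk_surjective) p this
  have ht : Module.IsTorsionBySet R N J := fun x a => hJ a a.2 x
  let _ := ht.module
  have := ht.isScalarTower (S := R)
  have : Module.Finite (R ⧸ J) N := Module.Finite.of_restrictScalars_finite R _ _
  exact isArtinian_of_surjective_algebraMap (R := R ⧸ J) Ideal.Quotient.mk_surjective

lemma melkersson (H : Type) [AddCommGroup H] [Module R H] (x : R)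
    (ht : ∀ h : H, ∃ n, x ^ n • h = 0) (K : Submodule R H) (hK : ∀ h, x • h = 0 → h ∈ K)
    [IsArtinian R K] : IsArtinian R H := by
  rw [← monotone_stabilizes_iff_artinian]
  intro f
  let N : ℕ → Submodule R H := fun j => OrderDual.ofDual (f j)
  have hN : ∀ i j, i ≤ j → N j ≤ N i := fun i j h => f.monotone h
  let B : ℕ → ℕ → Submodule R K := fun j t =>
    (((N j).map (LinearMap.lsmul R H (x ^ t))) ⊓ LinearMap.ker (LinearMap.lsmul R H x)).comap
      K.subtype
  have hB1 : ∀ i j t, i ≤ j → B j t ≤ B i t := fun i j t h =>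
    Submodule.comap_mono (inf_le_inf_right _ (Submodule.map_mono (hN i j h)))
  have hB2 : ∀ j s t, s ≤ t → B j t ≤ B j s := by
    rintro j s t h y ⟨⟨z, hz, hzy⟩, hy⟩
    refine ⟨⟨x ^ (t - s) • z, Submodule.smul_mem _ _ hz, ?_⟩, hy⟩
    rw [← hzy]
    simp only [LinearMap.lsmul_apply, smul_smul, ← pow_add]
    congr 2; omega
  have stab : ∀ C : ℕ → Submodule R K, (∀ i j, i ≤ j → C j ≤ C i) →
      ∃ n, ∀ m, n ≤ m → C n = C m := fun C hC =>
    monotone_stabilizes_iff_artinian.2 ‹IsArtinian R K› ⟨fun j => OrderDual.toDual (C j), hC⟩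
  obtain ⟨n0, h0⟩ := stab (fun j => B j j) fun i j h => (hB1 i j j h).trans (hB2 i i j h)
  choose nt hnt using fun t => stab (fun j => B j t) fun i j h => hB1 i j t h
  let n1 := max n0 ((Finset.range n0).sup nt)
  have key : ∀ j t, n1 ≤ j → B n1 t ≤ B j t := by
    intro j t hj
    rcases lt_or_ge t n0 with h | h
    · have h2 : nt t ≤ n1 := (Finset.le_sup (Finset.mem_range.2 h)).trans (le_max_right _ _)
      exact ((hnt t n1 h2).symm.trans (hnt t j (h2.trans hj))).le
    · calc B n1 t ≤ B n0 n0 := (hB1 _ _ _ (le_max_left _ _)).trans (hB2 _ _ _ h)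
        _ = B (max j t) (max j t) := h0 _ (h.trans (le_max_right _ _))
        _ ≤ B j t := (hB1 _ _ _ (le_max_left _ _)).trans (hB2 _ _ _ (le_max_right _ _))
  refine ⟨n1, fun j hj => ?_⟩
  have main : ∀ s, ∀ y ∈ N n1, x ^ s • y = 0 → y ∈ N j := by
    intro s
    induction s with
    | zero => intro y _ h; rw [pow_zero, one_smul] at h; rw [h]; exact zero_mem _
    | succ s ih =>
      intro y hy h
      have h3 : x • (x ^ s • y) = 0 := by rw [smul_smul, ← pow_succ']; exact h
      have h2 : (⟨x ^ s • y, hK _ h3⟩ : K) ∈ B n1 s := ⟨⟨y, hy, rfl⟩, h3⟩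
      obtain ⟨⟨z, hz, hzy⟩, -⟩ := key j s hj h2
      have h4 : y - z ∈ N j := ih _ (sub_mem hy (hN _ _ hj hz)) (by
        rw [smul_sub, sub_eq_zero]; exact hzy.symm)
      have := add_mem h4 hz
      rwa [sub_add_cancel] at this
  have : N n1 = N j := le_antisymm (fun y hy => by
    obtain ⟨s, hs⟩ := ht y
    exact main s y hy hs) (hN _ _ hj)
  exact this

lemma secondary (H : Type) [AddCommGroup H] [Module R H] [IsArtinian R H] (S : Submodule R H)
    (hS : SupIrred S) (a : R) :
    S.map (LinearMap.lsmul R H a) = S ∨ ∃ n, ∀ s ∈ S, a ^ n • s = 0 := by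
  let N : ℕ → Submodule R H := fun n => S.map (LinearMap.lsmul R H (a ^ n))
  have hN : ∀ s t, s ≤ t → N t ≤ N s := by
    rintro s t h y ⟨z, hz, hzy⟩
    refine ⟨a ^ (t - s) • z, Submodule.smul_mem _ _ hz, ?_⟩
    rw [← hzy]
    simp only [LinearMap.lsmul_apply, smul_smul, ← pow_add]
    congr 2; omega
  have hNS : ∀ n, N n ≤ S := by
    rintro n y ⟨z, hz, rfl⟩
    exact Submodule.smul_mem _ _ hz
  obtain ⟨n, hn⟩ := monotone_stabilizes_iff_artinian.2 ‹IsArtinian R H›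
    ⟨fun j => OrderDual.toDual (N j), hN⟩
  have hn2 : N n = N (n + n) := hn _ (Nat.le_add_left _ _)
  have hn1 : N n = N (n + 1) := hn _ (Nat.le_succ _)
  have hsup : N n ⊔ (S ⊓ LinearMap.ker (LinearMap.lsmul R H (a ^ n))) = S := by
    refine le_antisymm (sup_le (hNS n) inf_le_left) fun s hs => ?_
    have h1 : a ^ n • s ∈ N n := ⟨s, hs, rfl⟩
    rw [hn2] at h1
    obtain ⟨z, hz, hzs⟩ := h1
    rw [Submodule.mem_sup]
    refine ⟨a ^ n • z, ⟨z, hz, rfl⟩, s - a ^ n • z, ⟨sub_mem hs (Submodule.smul_mem _ _ hz), ?_⟩,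
      by abel⟩
    change a ^ n • (s - a ^ n • z) = 0
    rw [smul_sub, smul_smul, ← pow_add, sub_eq_zero]
    exact hzs.symm
  rcases hS.2 hsup with h | h
  · left
    refine le_antisymm (by rintro y ⟨z, hz, rfl⟩; exact Submodule.smul_mem _ _ hz) ?_
    have h3 : N (n + 1) ≤ N 1 := hN 1 (n + 1) (Nat.le_add_left _ _)
    rw [← hn1, h] at h3
    simpa only [N, pow_one] using h3
  · right
    refine ⟨n, fun s hs => ?_⟩
    rw [← h] at hs
    exact hs.2

lemma rad_prime (H : Type) [AddCommGroup H] [Module R H] [IsArtinian R H] (S : Submodule R H)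
    (hS : SupIrred S) : S.annihilator.radical.IsPrime ∧
      ∀ a, a ∉ S.annihilator.radical → S.map (LinearMap.lsmul R H a) = S := by
  have h2 : ∀ a, a ∉ S.annihilator.radical → S.map (LinearMap.lsmul R H a) = S := by
    intro a ha
    rcases secondary H S hS a with h | ⟨n, hn⟩
    · exact h
    · exact absurd ⟨n, Submodule.mem_annihilator.2 hn⟩ ha
  have hmap : ∀ a, S.map (LinearMap.lsmul R H a) = S → a ∉ S.annihilator.radical := by
    rintro a ha ⟨n, hn⟩
    have h3 : ∀ k, ∀ s ∈ S, ∃ t ∈ S, a ^ k • t = s := by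
      intro k
      induction k with
      | zero => exact fun s hs => ⟨s, hs, by simp⟩
      | succ k ih =>
        intro s hs
        obtain ⟨t, ht, hts⟩ := ih s hs
        rw [← ha] at ht
        obtain ⟨u, hu, rfl⟩ := ht
        exact ⟨u, hu, by rw [← hts, pow_succ, mul_smul]; rfl⟩
    refine hS.1 (fun T _ s hs => ?_)
    obtain ⟨t, ht, rfl⟩ := h3 n s hs
    rw [Submodule.mem_annihilator.1 hn t ht]
    exact zero_mem _
  refine ⟨⟨?_, ?_⟩, h2⟩
  · rw [Ne, Ideal.eq_top_iff_one]
    refine hmap 1 ?_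
    ext y
    simp
  · intro a b hab
    by_contra! hcon
    refine hmap (a * b) ?_ hab
    have e : LinearMap.lsmul R H (a * b) = LinearMap.lsmul R H a ∘ₗ LinearMap.lsmul R H b := by
      ext y
      exact mul_smul a b y
    rw [e]
    have : S.map (LinearMap.lsmul R H a ∘ₗ LinearMap.lsmul R H b) =
        (S.map (LinearMap.lsmul R H b)).map (LinearMap.lsmul R H a) := Submodule.map_comp _ _ _
    exact this.trans (by rw [h2 b hcon.2, h2 a hcon.1])

lemma exists_surj [IsNoetherianRing R] (H : Type) [AddCommGroup H] [Module R H] [IsArtinian R H]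
    (h : (𝔞 • ⊤ : Submodule R H) = ⊤) : ∃ x ∈ 𝔞, ∀ y : H, ∃ z : H, x • z = y := by
  classical
  obtain ⟨s, hs, hirr⟩ := exists_supIrred_decomposition (⊤ : Submodule R H)
  let t := s.filter fun S => ¬ 𝔞 ≤ S.annihilator.radical
  let u := s.filter fun S => 𝔞 ≤ S.annihilator.radical
  have hpow : ∀ n, (𝔞 ^ n • ⊤ : Submodule R H) = ⊤ := by
    intro n
    induction n with
    | zero => simp
    | succ n ih => rw [pow_succ, Submodule.mul_smul, h, ih]
  have hu : ∃ n, 𝔞 ^ n • u.sup id = ⊥ := by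
    refine Finset.sup_induction (p := fun W : Submodule R H => ∃ n, 𝔞 ^ n • W = ⊥)
      ⟨0, by simp⟩ ?_ ?_
    · rintro W ⟨n, hn⟩ W' ⟨m, hm⟩
      refine ⟨n + m, ?_⟩
      rw [Submodule.smul_sup, pow_add, Submodule.mul_smul, Submodule.mul_smul, hm, smul_smul,
        mul_comm, ← smul_smul, hn]
      simp
    · intro S hS
      obtain ⟨n, hn⟩ := Ideal.exists_pow_le_of_le_radical_of_fg (Finset.mem_filter.1 hS).2
        (IsNoetherian.noetherian 𝔞)
      refine ⟨n, eq_bot_iff.2 (Submodule.smul_le.2 fun a ha y hy => ?_)⟩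
      exact Submodule.mem_annihilator.1 (hn ha) y hy
  obtain ⟨n, hn⟩ := hu
  have htu : t.sup id ⊔ u.sup id = ⊤ := by
    rw [← Finset.sup_union, ← hs, Finset.union_comm, Finset.filter_union_filter_not_eq]
  have ht : t.sup id = ⊤ := by
    rw [eq_top_iff, ← hpow n, ← htu, Submodule.smul_sup, hn, sup_bot_eq]
    exact Submodule.smul_le_right
  have hx : ¬ ((𝔞 : Set R) ⊆ ⋃ S ∈ (t : Set (Submodule R H)), (S.annihilator.radical : Set R)) := by
    intro hcon
    obtain ⟨S, hS, hle⟩ := (Ideal.subset_union_prime (s := t)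
      (f := fun S : Submodule R H => S.annihilator.radical) ⊤ ⊤
      (fun S hS _ _ => (rad_prime H S (hirr (Finset.mem_filter.1 hS).1)).1)).1 hcon
    exact (Finset.mem_filter.1 hS).2 hle
  obtain ⟨x, hxa, hx⟩ := Set.not_subset.1 hx
  simp only [Set.mem_iUnion, not_exists] at hx
  refine ⟨x, hxa, fun y => ?_⟩
  have hle : t.sup id ≤ LinearMap.range (LinearMap.lsmul R H x) := by
    refine Finset.sup_le fun S hS => ?_
    rw [id, ← (rad_prime H S (hirr (Finset.mem_filter.1 hS).1)).2 x (hx S hS)]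
    exact LinearMap.map_le_range
  rw [ht] at hle
  exact hle (Submodule.mem_top (x := y))

end Alg

section Main
variable {R : Type} [CommRing R] (𝔞 : Ideal R)
  {A B C M : Type} [AddCommGroup A] [Module R A] [AddCommGroup B] [Module R B]
  [AddCommGroup C] [Module R C] [AddCommGroup M] [Module R M]

/-- unbundled local cohomology -/
abbrev LH (i : ℕ) (A : Type) [AddCommGroup A] [Module R A] : Type :=
  (localCohomology 𝔞 i).obj (ModuleCat.of R A)

/-- unbundled functoriality -/
def lm (i : ℕ) (f : A →ₗ[R] B) : LH 𝔞 i A →ₗ[R] LH 𝔞 i B :=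
  (Hmap 𝔞 i (ModuleCat.ofHom f)).hom

lemma lm_smul (i : ℕ) (a : R) (x : LH 𝔞 i A) : lm 𝔞 i (LinearMap.lsmul R A a) x = a • x :=
  Hmap_smul 𝔞 a i (ModuleCat.of R A) x

lemma les (f : A →ₗ[R] B) (g : B →ₗ[R] C) (hf : Function.Injective f)
    (hg : Function.Surjective g) (hfg : Function.Exact f g) (i : ℕ) :
    ∃ δ : LH 𝔞 i C →ₗ[R] LH 𝔞 (i + 1) A,
      Function.Exact (lm 𝔞 i f) (lm 𝔞 i g) ∧ Function.Exact (lm 𝔞 i g) δ ∧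
      Function.Exact δ (lm 𝔞 (i + 1) f) := by
  let S : ShortComplex (ModuleCat.{0} R) := ShortComplex.mk (ModuleCat.ofHom f) (ModuleCat.ofHom g)
    (by ext x; exact hfg.apply_apply_eq_zero x)
  have hS : S.ShortExact := by
    refine ShortComplex.ShortExact.mk' ?_ ?_ ?_
    · rw [ShortComplex.moduleCat_exact_iff]
      intro x hx
      exact (hfg x).1 hx
    · rw [ModuleCat.mono_iff_injective]; exact hf
    · rw [ModuleCat.epi_iff_surjective]; exact hg
  exact ⟨(Hδ 𝔞 hS i).hom, H_exact₂ 𝔞 hS i, H_exact₃ 𝔞 hS i, H_exact₁ 𝔞 hS i⟩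

lemma LH_inj (i : ℕ) [Module.Injective R A] (x : LH 𝔞 (i + 1) A) : x = 0 := by
  have := Module.injective_object_of_injective_module R A
  exact H_injective 𝔞 i (ModuleCat.of R A) x

/-- embedding in a torsion injective -/
lemma emb [IsNoetherianRing R] (T : Type) [AddCommGroup T] [Module R T] (hT : Gam 𝔞 T = ⊤) :
    ∃ (Q : Type) (_ : AddCommGroup Q) (_ : Module R Q) (j : T →ₗ[R] Q),
      Module.Injective R Q ∧ Gam 𝔞 Q = ⊤ ∧ Function.Injective j := by
  let I := Injective.under (ModuleCat.of R T)
  have : Module.Injective R I := by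
    have : Injective (ModuleCat.of R I) := inferInstanceAs (Injective I)
    exact Module.injective_module_of_injective_object R I
  let j : T →ₗ[R] I := (Injective.ι (ModuleCat.of R T)).hom
  have hj : Function.Injective j :=
    (ModuleCat.mono_iff_injective (Injective.ι (ModuleCat.of R T))).1 inferInstance
  refine ⟨Gam 𝔞 I, inferInstance, inferInstance, j.codRestrict _ fun t => ?_,
    Gam_injective 𝔞 I, ?_, fun x y h => hj (congrArg Subtype.val h)⟩
  · have ht : t ∈ Gam 𝔞 T := hT ▸ Submodule.mem_top
    obtain ⟨n, hn⟩ := ht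
    exact ⟨n, fun a ha => by rw [← map_smul, hn a ha, map_zero]⟩
  · rw [eq_top_iff]
    rintro ⟨q, n, hn⟩ -
    exact ⟨n, fun a ha => Subtype.ext (hn a ha)⟩

lemma quot_torsion (K : Submodule R A) (h : Gam 𝔞 A = ⊤) : Gam 𝔞 (A ⧸ K) = ⊤ := by
  rw [eq_top_iff]
  rintro q -
  obtain ⟨q, rfl⟩ := Submodule.Quotient.mk_surjective _ q
  have hq : q ∈ Gam 𝔞 A := h ▸ Submodule.mem_top
  obtain ⟨n, hn⟩ := hq
  exact ⟨n, fun a ha => by rw [← Submodule.Quotient.mk_smul, hn a ha, Submodule.Quotient.mk_zero]⟩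

lemma lm_zero_surj (g : A →ₗ[R] B) (hg : Function.Surjective g) (h : Gam 𝔞 A = ⊤) :
    Function.Surjective (lm 𝔞 0 g) := by
  intro x
  obtain ⟨n, q, hq, rfl⟩ := el_rep 𝔞 (ModuleCat.of R B) x
  obtain ⟨p, rfl⟩ := hg q
  have hp : p ∈ Gam 𝔞 A := h ▸ Submodule.mem_top
  obtain ⟨m, hm⟩ := hp
  have hm' : ∀ a ∈ 𝔞 ^ m, a • g p = 0 := fun a ha => by rw [← map_smul, hm a ha, map_zero]
  refine ⟨el 𝔞 (ModuleCat.of R A) m p hm, ?_⟩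
  exact (Hmap_el 𝔞 (ModuleCat.ofHom g) m p hm hm').trans (el_indep 𝔞 (ModuleCat.of R B) _ hq hm')

lemma torsion_acyclic [IsNoetherianRing R] (i : ℕ) : ∀ (T : Type) [AddCommGroup T] [Module R T],
    Gam 𝔞 T = ⊤ → ∀ x : LH 𝔞 (i + 1) T, x = 0 := by
  induction i with
  | zero =>
    intro T _ _ hT x
    obtain ⟨Q, _, _, j, hQ, hQt, hj⟩ := emb 𝔞 T hT
    obtain ⟨δ, h1, h2, h3⟩ := les 𝔞 j (LinearMap.range j).mkQ hj (Submodule.mkQ_surjective _)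
      (LinearMap.exact_map_mkQ_range j) 0
    obtain ⟨z, rfl⟩ := (h3 x).1 (LH_inj 𝔞 0 _)
    obtain ⟨w, rfl⟩ := lm_zero_surj 𝔞 _ (Submodule.mkQ_surjective (LinearMap.range j)) hQt z
    exact h2.apply_apply_eq_zero w
  | succ i ih =>
    intro T _ _ hT x
    obtain ⟨Q, _, _, j, hQ, hQt, hj⟩ := emb 𝔞 T hT
    obtain ⟨δ, h1, h2, h3⟩ := les 𝔞 j (LinearMap.range j).mkQ hj (Submodule.mkQ_surjective _)
      (LinearMap.exact_map_mkQ_range j) (i + 1)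
    obtain ⟨z, rfl⟩ := (h3 x).1 (LH_inj 𝔞 (i + 1) _)
    rw [ih _ (quot_torsion 𝔞 _ hQt) z, map_zero]

lemma Gam_Gam : Gam 𝔞 (Gam 𝔞 A) = ⊤ := by
  rw [eq_top_iff]
  rintro ⟨q, n, hn⟩ -
  exact ⟨n, fun a ha => Subtype.ext (hn a ha)⟩

lemma mod_Gam_inj [IsNoetherianRing R] (i : ℕ) :
    Function.Injective (lm 𝔞 (i + 1) (Gam 𝔞 A).mkQ) := by
  obtain ⟨δ, h1, h2, h3⟩ := les 𝔞 (Gam 𝔞 A).subtype (Gam 𝔞 A).mkQ (Subtype.val_injective)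
    (Submodule.mkQ_surjective _) (LinearMap.exact_subtype_mkQ _) (i + 1)
  rw [injective_iff_map_eq_zero]
  intro x hx
  obtain ⟨y, rfl⟩ := (h1 x).1 hx
  rw [torsion_acyclic 𝔞 i _ (Gam_Gam 𝔞) y, map_zero]

lemma mod_Gam_surj [IsNoetherianRing R] (i : ℕ) :
    Function.Surjective (lm 𝔞 i (Gam 𝔞 A).mkQ) := by
  obtain ⟨δ, h1, h2, h3⟩ := les 𝔞 (Gam 𝔞 A).subtype (Gam 𝔞 A).mkQ (Subtype.val_injective)
    (Submodule.mkQ_surjective _) (LinearMap.exact_subtype_mkQ _) i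
  intro x
  exact (h2 x).1 (torsion_acyclic 𝔞 i _ (Gam_Gam 𝔞) _)

/-- the long exact sequence of multiplication by a regular element -/
lemma les_smul (x : R) (hx : IsSMulRegular A x) (i : ℕ) :
    ∃ δ : LH 𝔞 i (A ⧸ LinearMap.range (LinearMap.lsmul R A x)) →ₗ[R] LH 𝔞 (i + 1) A,
      (∀ y, lm 𝔞 i (LinearMap.range (LinearMap.lsmul R A x)).mkQ y = 0 → ∃ z, x • z = y) ∧
      Function.Exact (lm 𝔞 i (LinearMap.range (LinearMap.lsmul R A x)).mkQ) δ ∧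
      (∀ y : LH 𝔞 (i + 1) A, x • y = 0 → y ∈ LinearMap.range δ) := by
  obtain ⟨δ, h1, h2, h3⟩ := les 𝔞 (LinearMap.lsmul R A x)
    (LinearMap.range (LinearMap.lsmul R A x)).mkQ hx (Submodule.mkQ_surjective _)
    (LinearMap.exact_map_mkQ_range _) i
  refine ⟨δ, fun y hy => ?_, h2, fun y hy => ?_⟩
  · obtain ⟨z, rfl⟩ := (h1 y).1 hy
    exact ⟨z, (lm_smul 𝔞 i x z).symm⟩
  · exact (h3 y).1 ((lm_smul 𝔞 (i + 1) x y).trans hy)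

lemma H0_artinian [IsNoetherianRing R] [Module.Finite R M]
    (hp : ∀ p : Ideal R, p.IsPrime → 𝔞 ≤ p → Module.annihilator R M ≤ p → p.IsMaximal) :
    IsArtinian R (LH 𝔞 0 M) := by
  obtain ⟨k, hk⟩ := unif 𝔞 (LinearMap.id : M →ₗ[R] M)
  have hs := el_surj 𝔞 (ModuleCat.of R M) k hk
  let X := Rn 𝔞 k ⟶ ModuleCat.of R M
  let ev : X →ₗ[R] M :=
    { toFun := fun φ => φ (Submodule.Quotient.mk 1)
      map_add' := fun _ _ => rfl
      map_smul' := fun _ _ => rfl }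
  have hev : Function.Injective ev := by
    intro φ ψ h
    ext : 1
    refine Submodule.linearMap_qext _ ?_
    ext
    exact h
  have : IsNoetherian R X := isNoetherian_of_injective ev hev
  have hX : IsArtinian R X := by
    refine artin_of_prime X (𝔞 ^ k ⊔ Module.annihilator R M) ?_ ?_
    · intro a ha φ
      apply hev
      rw [map_smul, map_zero]
      obtain ⟨b, hb, c, hc, rfl⟩ := Submodule.mem_sup.1 ha
      rw [add_smul, Module.mem_annihilator.1 hc, add_zero]
      change b • φ (Submodule.Quotient.mk 1) = 0
      rw [← map_smul φ.hom, ← Submodule.Quotient.mk_smul,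
        (Submodule.Quotient.mk_eq_zero (𝔞 ^ k)).2 (by simpa using hb)]
      exact map_zero φ.hom
    · intro p hpp hle
      exact hp p hpp (hpp.le_of_pow_le (le_sup_left.trans hle)) (le_sup_right.trans hle)
  exact isArtinian_of_surjective X ((E0 (Rn 𝔞 k) (ModuleCat.of R M)).hom ≫ ι 𝔞 0 k _).hom hs

lemma ann_quot (K : Submodule R M) : Module.annihilator R M ≤ Module.annihilator R (M ⧸ K) :=
  LinearMap.annihilator_le_of_surjective K.mkQ (Submodule.mkQ_surjective _)

lemma LH_artinian [IsNoetherianRing R] (i : ℕ) : ∀ (M : Type) [AddCommGroup M] [Module R M]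
    [Module.Finite R M],
    (∀ p : Ideal R, p.IsPrime → 𝔞 ≤ p → Module.annihilator R M ≤ p → p.IsMaximal) →
    IsArtinian R (LH 𝔞 i M) := by
  induction i with
  | zero => intro M _ _ _ hp; exact H0_artinian 𝔞 hp
  | succ i ih =>
    intro M _ _ _ hp
    have : IsNoetherian R M := inferInstance
    let M' := M ⧸ Gam 𝔞 M
    have hp' : ∀ p : Ideal R, p.IsPrime → 𝔞 ≤ p → Module.annihilator R M' ≤ p → p.IsMaximal :=
      fun p h1 h2 h3 => hp p h1 h2 ((ann_quot _).trans h3)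
    suffices h : IsArtinian R (LH 𝔞 (i + 1) M') from
      isArtinian_of_injective (lm 𝔞 (i + 1) (Gam 𝔞 M).mkQ) (mod_Gam_inj 𝔞 i)
    obtain ⟨x, hxa, hx⟩ := exists_reg 𝔞 M' (Gam_quot 𝔞)
    obtain ⟨δ, h1, h2, h3⟩ := les_smul 𝔞 x hx i
    have hA : IsArtinian R (LH 𝔞 i (M' ⧸ LinearMap.range (LinearMap.lsmul R M' x))) :=
      ih _ fun p h1 h2 h3 => hp' p h1 h2 ((ann_quot _).trans h3)
    have : IsArtinian R (LinearMap.range δ) :=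
      isArtinian_of_surjective _ δ.rangeRestrict δ.surjective_rangeRestrict
    refine melkersson _ x (fun h => ?_) (LinearMap.range δ) h3
    obtain ⟨n, hn⟩ := H_torsion 𝔞 (i + 1) _ h
    exact ⟨n, hn _ (Ideal.pow_mem_pow hxa n)⟩

lemma smul_top_aux (c : ℕ) [IsNoetherianRing R] (M : Type) [AddCommGroup M] [Module R M]
    [Module.Finite R M] (N : Submodule R M) :
    ∀ (M' : Type) [AddCommGroup M'] [Module R M'] (π : M →ₗ[R] M'), Function.Surjective π →
      LinearMap.ker π = N → (∀ i, c + 1 < i → ∀ x : LH 𝔞 i M', x = 0) →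
      (𝔞 • ⊤ : Submodule R (LH 𝔞 (c + 1) M')) = ⊤ := by
  have : WellFoundedGT (Submodule R M) := inferInstance
  induction N using WellFoundedGT.induction with
  | ind N ih =>
  intro M' _ _ π hπ hN hv
  have : Module.Finite R M' := Module.Finite.of_surjective π hπ
  have step : ∀ K : Submodule R M', K ≠ ⊥ →
      (∀ i, c + 1 < i → ∀ x : LH 𝔞 i (M' ⧸ K), x = 0) →
      (𝔞 • ⊤ : Submodule R (LH 𝔞 (c + 1) (M' ⧸ K))) = ⊤ := by
    intro K hK hv'
    refine ih (K.comap π) ?_ (M' ⧸ K) (K.mkQ ∘ₗ π) ((Submodule.mkQ_surjective K).comp hπ) ?_ hv'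
    · rw [← hN]
      refine lt_of_le_of_ne (LinearMap.ker_le_comap π) fun h => hK ?_
      rw [eq_bot_iff]
      intro y hy
      obtain ⟨m, rfl⟩ := hπ y
      have : m ∈ K.comap π := hy
      rw [← h] at this
      exact this
    · rw [LinearMap.ker_comp, Submodule.ker_mkQ]
  have pull : ∀ K : Submodule R M', Function.Surjective (lm 𝔞 (c + 1) K.mkQ) →
      (𝔞 • ⊤ : Submodule R (LH 𝔞 (c + 1) (M' ⧸ K))) = ⊤ →
      ∀ y : LH 𝔞 (c + 1) M', ∃ z ∈ (𝔞 • ⊤ : Submodule R (LH 𝔞 (c + 1) M')),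
        lm 𝔞 (c + 1) K.mkQ z = lm 𝔞 (c + 1) K.mkQ y := by
    intro K hs ht y
    have h1 : lm 𝔞 (c + 1) K.mkQ y ∈
        (𝔞 • ⊤ : Submodule R (LH 𝔞 (c + 1) M')).map (lm 𝔞 (c + 1) K.mkQ) := by
      rw [Submodule.map_smul'', Submodule.map_top, LinearMap.range_eq_top.2 hs, ht]
      trivial
    obtain ⟨z, hz, h⟩ := h1
    exact ⟨z, hz, h⟩
  rw [eq_top_iff]
  rintro y -
  by_cases hG : Gam 𝔞 M' = ⊥
  · obtain ⟨x, hxa, hx⟩ := exists_reg 𝔞 M' hG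
    let K := LinearMap.range (LinearMap.lsmul R M' x)
    have hyx : (∃ z, x • z = y) → y ∈ (𝔞 • ⊤ : Submodule R (LH 𝔞 (c + 1) M')) := by
      rintro ⟨z, rfl⟩
      exact Submodule.smul_mem_smul hxa trivial
    by_cases hK : K = ⊥
    · have h0 : ∀ m : M', m = 0 := fun m => by
        have : x • m ∈ K := ⟨m, rfl⟩
        rw [hK, Submodule.mem_bot] at this
        exact hx (this.trans (smul_zero x).symm)
      have e : LinearMap.lsmul R M' 1 = LinearMap.lsmul R M' 0 := by
        ext m
        rw [h0 m, map_zero, map_zero]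
      have : y = 0 := by
        rw [← one_smul R y, ← lm_smul, e, lm_smul, zero_smul]
      rw [this]
      exact zero_mem _
    · have hsurj : ∀ i, c + 1 ≤ i → Function.Surjective (lm 𝔞 i K.mkQ) := by
        intro i hi z
        obtain ⟨δ, h1, h2, h3⟩ := les_smul 𝔞 x hx i
        exact (h2 z).1 (hv (i + 1) (by omega) _)
      obtain ⟨z, hz, hzy⟩ := pull K (hsurj _ le_rfl) (step K hK fun i hi z => by
        obtain ⟨w, rfl⟩ := hsurj i hi.le z
        rw [hv i hi w, map_zero]) y
      obtain ⟨δ, h1, h2, h3⟩ := les_smul 𝔞 x hx (c + 1)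
      obtain ⟨w, hw⟩ := h1 (y - z) (by
        rw [map_sub, sub_eq_zero]; exact hzy.symm)
      have := add_mem (Submodule.smul_mem_smul hxa (Submodule.mem_top (x := w))) hz
      rwa [hw, sub_add_cancel] at this
  · obtain ⟨z, hz, hzy⟩ := pull (Gam 𝔞 M') (mod_Gam_surj 𝔞 _) (step _ hG fun i hi z => by
      obtain ⟨w, rfl⟩ := mod_Gam_surj 𝔞 i z
      rw [hv i hi w, map_zero]) y
    rwa [← mod_Gam_inj 𝔞 c hzy]

end Main
end
end LCAux

/-- Corollary 2.9: over a complete local ring, if `M` is relative Cohen-Macaulay w.r.t. `𝔞`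
with `c = cd(𝔞,M) > 0` and `Supp(M/𝔞M) ⊆ V(𝔪)`, then `𝔞` contains a regular element on
`D_R(H^c_𝔞(M))`. -/
theorem stmt6 {R : Type} [CommRing R] [IsNoetherianRing R] [IsLocalRing R]
    [IsAdicComplete (IsLocalRing.maximalIdeal R) R]
    (𝔞 : Ideal R) (h𝔞 : 𝔞 ≠ ⊤)
    (M : Type) [AddCommGroup M] [Module R M] [Module.Finite R M]
    (hCM : IsRelCM 𝔞 M)
    (c : ℕ) (hc : c = cohDim 𝔞 M) (hc0 : 0 < c)
    (hsupp : Module.support R (M ⧸ (𝔞 • ⊤ : Submodule R M)) ⊆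
      PrimeSpectrum.zeroLocus ((IsLocalRing.maximalIdeal R : Ideal R) : Set R))
    (E : Type) [AddCommGroup E] [Module R E]
    (f : IsLocalRing.ResidueField R →ₗ[R] E) (hE : IsInjectiveHull R f) :
    ∃ x ∈ 𝔞, IsSMulRegular (((localCohomology 𝔞 c).obj (ModuleCat.of R M)) →ₗ[R] E) x := by
  obtain ⟨c0, hc0'⟩ := hCM
  have hcc : c = c0 := by
    have e : {i : ℕ | Nontrivial ((localCohomology 𝔞 i).obj (ModuleCat.of R M))} = {c0} := by
      ext i
      exact hc0' i
    rw [hc, cohDim, e]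
    exact csSup_singleton c0
  subst hcc
  obtain ⟨d, rfl⟩ : ∃ d, c = d + 1 := ⟨c - 1, by omega⟩
  have hv : ∀ i, d + 1 < i → ∀ x : LCAux.LH 𝔞 i M, x = 0 := by
    intro i hi x
    by_contra hx
    have : i = d + 1 := (hc0' i).1 ⟨x, 0, hx⟩
    omega
  have hp : ∀ p : Ideal R, p.IsPrime → 𝔞 ≤ p → Module.annihilator R M ≤ p → p.IsMaximal := by
    intro p hpp h1 h2
    have hm : IsLocalRing.maximalIdeal R ≤ p := by
      have : (⟨p, hpp⟩ : PrimeSpectrum R) ∈ Module.support R (M ⧸ (𝔞 • ⊤ : Submodule R M)) := by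
        rw [Module.support_quotient, Module.support_eq_zeroLocus]
        exact ⟨h2, h1⟩
      exact hsupp this
    have : p = IsLocalRing.maximalIdeal R := le_antisymm (IsLocalRing.le_maximalIdeal hpp.ne_top) hm
    rw [this]
    exact IsLocalRing.maximalIdeal.isMaximal R
  have hart : IsArtinian R (LCAux.LH 𝔞 (d + 1) M) := LCAux.LH_artinian 𝔞 (d + 1) M hp
  have htop := LCAux.smul_top_aux 𝔞 d M _ M LinearMap.id Function.surjective_id rfl hv
  obtain ⟨x, hxa, hx⟩ := LCAux.exists_surj 𝔞 (LCAux.LH 𝔞 (d + 1) M) htop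
  refine ⟨x, hxa, fun φ ψ h => LinearMap.ext fun y => ?_⟩
  obtain ⟨z, rfl⟩ := hx y
  rw [map_smul, map_smul]
  exact LinearMap.congr_fun h z
end

section
/- Let (R,𝔪) be a complete Noetherian local ring, 𝔞 ⊊ R a proper ideal, c a non-negative integer, and M a finite R-module such that H^i_𝔞(M) = 0 for all i < c and Supp_R(M/𝔞M) ⊆ V(𝔪). If Hom_R(R/𝔞, D_R(H^c_𝔞(M))) = 0, then 𝔞 contains a regular element (non-zerodivisor) on D_R(H^c_𝔞(M)). -/
open CategoryTheory

namespace LC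
open CategoryTheory Limits Opposite
noncomputable section
variable {R : Type} [CommRing R]

/-- If `ker x` is Artinian and `H` is `x`-power torsion then `H` is Artinian. -/
lemma artinian_of_torsion {H : Type} [AddCommGroup H] [Module R H] (x : R)
    (hx : ∀ h : H, ∃ t : ℕ, x ^ t • h = 0)
    (hk : IsArtinian R (LinearMap.ker (LinearMap.lsmul R H x))) : IsArtinian R H := by
  set K := LinearMap.ker (LinearMap.lsmul R H x) with hK
  have memK : ∀ h : H, h ∈ K ↔ x • h = 0 := fun h => Iff.rfl
  let pc : Submodule R H → ℕ → Submodule R K := fun N j =>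
    { carrier := {k | ∃ u ∈ N, x ^ j • u = k.1}
      zero_mem' := ⟨0, N.zero_mem, by simp⟩
      add_mem' := by
        rintro a b ⟨u, hu, e⟩ ⟨v, hv, e'⟩
        exact ⟨u + v, N.add_mem hu hv, by rw [smul_add, e, e']; rfl⟩
      smul_mem' := by
        rintro r a ⟨u, hu, e⟩
        exact ⟨r • u, N.smul_mem r hu, by rw [smul_comm, e]; rfl⟩ }
  have mem_pc : ∀ N j k, k ∈ pc N j ↔ ∃ u ∈ N, x ^ j • u = k.1 := fun _ _ _ => Iff.rfl
  have pc_mono : ∀ N N' j, N ≤ N' → pc N j ≤ pc N' j := by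
    rintro N N' j h k ⟨u, hu, e⟩
    exact ⟨u, h hu, e⟩
  have pc_succ : ∀ N j j', j ≤ j' → pc N j' ≤ pc N j := by
    rintro N j j' h k ⟨u, hu, e⟩
    obtain ⟨d, rfl⟩ := Nat.exists_eq_add_of_le h
    exact ⟨x ^ d • u, N.smul_mem _ hu, by rw [smul_smul, ← pow_add, e]⟩
  have key : ∀ N N' : Submodule R H, N ≤ N' → (∀ j, pc N' j ≤ pc N j) → N' ≤ N := by
    intro N N' hN hj
    have : ∀ t : ℕ, ∀ u ∈ N', x ^ t • u = 0 → u ∈ N := by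
      intro t
      induction t with
      | zero => intro u _ h; simp at h; rw [h]; exact N.zero_mem
      | succ t ih =>
        intro u hu h
        have h1 : x ^ t • u ∈ K := by rw [memK, smul_smul, ← pow_succ', h]
        obtain ⟨v, hv, e⟩ := hj t (show (⟨_, h1⟩ : K) ∈ pc N' t from ⟨u, hu, rfl⟩)
        have h2 := ih (u - v) (N'.sub_mem hu (hN hv)) (by
          rw [smul_sub, e]; simp)
        have := N.add_mem h2 hv
        simpa using this
    intro u hu
    obtain ⟨t, ht⟩ := hx u
    exact this t u hu ht
  refine monotone_stabilizes_iff_artinian.1 fun f => ?_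
  have fmono : ∀ a b, a ≤ b → OrderDual.ofDual (f b) ≤ OrderDual.ofDual (f a) :=
    fun a b h => f.monotone h
  obtain ⟨k0, hk0⟩ := IsArtinian.monotone_stabilizes (R := R) (M := K)
    ⟨fun k => OrderDual.toDual (pc (OrderDual.ofDual (f k)) k), fun a b h =>
      show pc _ _ ≤ pc _ _ from (pc_mono _ _ _ (fmono a b h)).trans (pc_succ _ _ _ h)⟩
  have hst : ∀ j, ∃ k, ∀ m, k ≤ m →
      pc (OrderDual.ofDual (f k)) j = pc (OrderDual.ofDual (f m)) j := fun j =>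
    IsArtinian.monotone_stabilizes (R := R) (M := K)
      ⟨fun k => OrderDual.toDual (pc (OrderDual.ofDual (f k)) j), fun a b h =>
      show pc _ _ ≤ pc _ _ from (pc_mono _ _ _ (fmono a b h))⟩
  choose k hk using hst
  let B := k0 + ∑ j ∈ Finset.range k0, k j
  refine ⟨B, fun m hm => ?_⟩
  apply le_antisymm (f.monotone hm)
  refine key _ _ (fmono _ _ hm) fun j => ?_
  have hB : k0 ≤ B := Nat.le_add_right _ _
  rcases lt_or_ge j k0 with hj | hj
  · have hle : k j ≤ B := (Finset.single_le_sum (f := k) (fun _ _ => Nat.zero_le _)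
      (Finset.mem_range.2 hj)).trans (Nat.le_add_left _ _)
    exact ((hk j B hle).symm.trans (hk j m (hle.trans hm))).le
  · have e1 : pc (OrderDual.ofDual (f k0)) k0 = pc (OrderDual.ofDual (f (max m j))) (max m j) :=
      hk0 (max m j) ((hB.trans hm).trans (le_max_left _ _))
    calc pc (OrderDual.ofDual (f B)) j ≤ pc (OrderDual.ofDual (f k0)) k0 :=
          (pc_mono _ _ _ (fmono _ _ hB)).trans (pc_succ _ _ _ hj)
      _ = _ := e1
      _ ≤ pc (OrderDual.ofDual (f m)) j :=
          (pc_mono _ _ _ (fmono _ _ (le_max_left _ _))).trans (pc_succ _ _ _ (le_max_right _ _))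

lemma exists_surj [IsNoetherianRing R] {H : Type} [AddCommGroup H] [Module R H] [IsArtinian R H] (𝔞 : Ideal R)
    (h : 𝔞 • (⊤ : Submodule R H) = ⊤) : ∃ x ∈ 𝔞, ∀ y : H, ∃ z, x • z = y := by
  classical
  obtain ⟨s, hs, hirr⟩ := exists_supIrred_decomposition (⊤ : Submodule R H)
  have sec : ∀ N ∈ s, ∀ x : R, (∀ y ∈ N, ∃ z ∈ N, x • z = y) ∨ ∃ n : ℕ, ∀ y ∈ N, x ^ n • y = 0 := by
    intro N hN x
    obtain ⟨n, hn⟩ := IsArtinian.range_smul_pow_stabilizes N x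
    have h1 : N = N.map (LinearMap.lsmul R H (x ^ n)) ⊔
        (N ⊓ LinearMap.ker (LinearMap.lsmul R H (x ^ n))) := by
      apply le_antisymm
      · intro y hy
        have h2 : x ^ n • (⟨y, hy⟩ : N) ∈ LinearMap.range (x ^ (n + n) • LinearMap.id : N →ₗ[R] N) := by
          rw [← hn (n + n) (by omega)]
          exact ⟨⟨y, hy⟩, rfl⟩
        obtain ⟨⟨w, hw⟩, e⟩ := h2
        have e' : x ^ (n + n) • w = x ^ n • y := congrArg Subtype.val e
        refine Submodule.mem_sup.2 ⟨x ^ n • w, ⟨w, hw, rfl⟩, y - x ^ n • w,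
          ⟨N.sub_mem hy (N.smul_mem _ hw), ?_⟩, by abel⟩
        change x ^ n • (y - x ^ n • w) = 0
        rw [smul_sub, smul_smul, ← pow_add, e', sub_self]
      · refine sup_le ?_ inf_le_left
        rintro _ ⟨w, hw, rfl⟩
        exact N.smul_mem _ hw
    rcases (hirr hN).2 h1.symm with h3 | h3
    · left
      have : ∀ y ∈ N, ∃ z ∈ N, x ^ n • z = y := by
        intro y hy
        rw [← h3] at hy
        exact hy
      intro y hy
      obtain ⟨z, hz, e⟩ := this y hy
      obtain ⟨z', hz', e'⟩ := this z hz
      rcases n with _ | n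
      · simp at h3
        have h2 : (⟨y, hy⟩ : N) ∈ LinearMap.range (x ^ 1 • LinearMap.id : N →ₗ[R] N) := by
          rw [← hn 1 (by omega)]
          exact ⟨⟨y, hy⟩, by simp⟩
        obtain ⟨⟨w, hw⟩, e⟩ := h2
        exact ⟨w, hw, by simpa using congrArg Subtype.val e⟩
      · exact ⟨x ^ n • z, N.smul_mem _ hz, by rw [smul_smul, ← pow_succ', e]⟩
    · right
      refine ⟨n, fun y hy => ?_⟩
      rw [← h3] at hy
      exact hy.2
  have nz : ∀ N ∈ s, N ≠ ⊥ := fun N hN e => (hirr hN).1 (e ▸ isMin_bot)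
  let p : Submodule R H → Ideal R := fun N => N.annihilator.radical
  have mem_p : ∀ N x, x ∈ p N ↔ ∃ n : ℕ, ∀ y ∈ N, x ^ n • y = 0 := by
    intro N x
    simp only [p, Ideal.radical, Submodule.mem_annihilator]
    rfl
  have hp : ∀ N ∈ s, (p N).IsPrime := by
    intro N hN
    refine ⟨fun e => ?_, fun {a b} hab => ?_⟩
    · have : (1 : R) ∈ p N := by rw [e]; trivial
      obtain ⟨n, hn⟩ := (mem_p _ _).1 this
      apply nz N hN
      rw [eq_bot_iff]
      intro y hy
      simpa using hn y hy
    · by_contra hcon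
      push Not at hcon
      have ha := (sec N hN a).resolve_right (fun e => hcon.1 ((mem_p _ _).2 e))
      have hb := (sec N hN b).resolve_right (fun e => hcon.2 ((mem_p _ _).2 e))
      obtain ⟨n, hn⟩ := (mem_p _ _).1 hab
      have hs : ∀ c : R, (∀ y ∈ N, ∃ z ∈ N, c • z = y) → ∀ n : ℕ, ∀ y ∈ N, ∃ z ∈ N, c ^ n • z = y := by
        intro c hc n
        induction n with
        | zero => intro y hy; exact ⟨y, hy, by simp⟩
        | succ n ih =>
          intro y hy
          obtain ⟨z, hz, rfl⟩ := ih y hy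
          obtain ⟨w, hw, rfl⟩ := hc z hz
          exact ⟨w, hw, by rw [pow_succ, smul_smul]⟩
      apply nz N hN
      rw [eq_bot_iff]
      intro y hy
      obtain ⟨z, hz, rfl⟩ := hs a ha n y hy
      obtain ⟨w, hw, rfl⟩ := hs b hb n z hz
      rw [smul_smul, ← mul_pow, hn w hw]
      exact zero_mem _
  let s' := s.filter fun N => ¬ 𝔞 ≤ p N
  have h1 : ∃ x ∈ 𝔞, ∀ N ∈ s', x ∉ p N := by
    by_contra hcon
    push Not at hcon
    have : (𝔞 : Set R) ⊆ ⋃ N ∈ (s' : Set (Submodule R H)), p N := by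
      intro x hx
      obtain ⟨N, hN, h⟩ := hcon x hx
      exact Set.mem_biUnion hN h
    rw [Ideal.subset_union_prime (⊥ : Submodule R H) ⊥
      (fun N hN _ _ => hp N (Finset.mem_filter.1 hN).1)] at this
    obtain ⟨N, hN, h⟩ := this
    exact (Finset.mem_filter.1 hN).2 h
  obtain ⟨x, hx, hxN⟩ := h1
  refine ⟨x, hx, ?_⟩
  have hpow : ∀ n : ℕ, 𝔞 ^ n • (⊤ : Submodule R H) = ⊤ := by
    intro n
    induction n with
    | zero => simp
    | succ n ih => rw [pow_succ, Submodule.mul_smul, h, ih]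
  have hnil : ∀ N ∈ s, 𝔞 ≤ p N → ∃ n : ℕ, 𝔞 ^ n • N = ⊥ := by
    intro N hN hle
    obtain ⟨n, hn⟩ := Ideal.exists_pow_le_of_le_radical_of_fg hle (IsNoetherian.noetherian 𝔞)
    refine ⟨n, ?_⟩
    rw [eq_bot_iff, Submodule.smul_le]
    intro r hr y hy
    exact (Submodule.mem_annihilator.1 (hn hr)) y hy
  have hnil' : ∀ N : Submodule R H, ∃ n : ℕ, N ∈ s → 𝔞 ≤ p N → 𝔞 ^ n • N = ⊥ := by
    intro N
    by_cases h1 : N ∈ s ∧ 𝔞 ≤ p N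
    · obtain ⟨n, hn⟩ := hnil N h1.1 h1.2
      exact ⟨n, fun _ _ => hn⟩
    · exact ⟨0, fun a b => absurd ⟨a, b⟩ h1⟩
  choose n hn using hnil'
  let W := s'.sup id
  have hW : ∀ a ∈ 𝔞 ^ (∑ N ∈ s, n N), ∀ y : H, a • y ∈ W := by
    intro a ha y
    have : s.sup id ≤ W.comap (LinearMap.lsmul R H a) := by
      refine Finset.sup_le fun N hN => ?_
      intro z hz
      change a • z ∈ W
      by_cases hle : 𝔞 ≤ p N
      · have h2 : a • z ∈ 𝔞 ^ n N • N := Submodule.smul_mem_smul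
          (Ideal.pow_le_pow_right (Finset.single_le_sum (fun _ _ => Nat.zero_le _) hN) ha) hz
        rw [hn N hN hle] at h2
        rw [(Submodule.mem_bot R).1 h2]
        exact W.zero_mem
      · have h2 : N ≤ W := Finset.le_sup (f := id) (Finset.mem_filter.2 ⟨hN, hle⟩)
        exact h2 (N.smul_mem _ hz)
    rw [hs] at this
    exact this (Submodule.mem_top (x := y))
  have hWtop : W = ⊤ := by
    rw [eq_top_iff, ← hpow (∑ N ∈ s, n N), Submodule.smul_le]
    exact fun r hr y _ => hW r hr y
  have hWr : W ≤ LinearMap.range (LinearMap.lsmul R H x) := by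
    refine Finset.sup_le fun N hN => ?_
    intro y hy
    obtain ⟨z, _, e⟩ := (sec N (Finset.mem_filter.1 hN).1 x).resolve_right
      (fun e => hxN N hN ((mem_p _ _).2 e)) y hy
    exact ⟨z, e⟩
  intro y
  rw [hWtop] at hWr
  exact hWr (Submodule.mem_top (x := y))

lemma artinian_of_support [IsNoetherianRing R] [IsLocalRing R] {M : Type} [AddCommGroup M]
   [Module R M] [Module.Finite R M] (h : Module.support R M ⊆
      PrimeSpectrum.zeroLocus ((IsLocalRing.maximalIdeal R : Ideal R) : Set R)) :
    IsArtinian R M := by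
  let I := Module.annihilator R M
  have h1 : IsArtinianRing (R ⧸ I) := by
    rw [isArtinianRing_iff_isNoetherianRing_krullDimLE_zero]
    refine ⟨inferInstance, Ring.krullDimLE_zero_iff.2 fun J hJ => ?_⟩
    have h2 : (⟨J.comap (Ideal.Quotient.mk I), inferInstance⟩ : PrimeSpectrum R) ∈
        Module.support R M := by
      rw [Module.mem_support_iff_of_finite]
      intro r hr
      change Ideal.Quotient.mk I r ∈ J
      rw [Ideal.Quotient.eq_zero_iff_mem.2 hr]
      exact J.zero_mem
    have h3 : IsLocalRing.maximalIdeal R ≤ J.comap (Ideal.Quotient.mk I) := h h2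
    have h4 : IsLocalRing.maximalIdeal R = J.comap (Ideal.Quotient.mk I) :=
      (IsLocalRing.maximalIdeal.isMaximal R).eq_of_le (Ideal.IsPrime.ne_top inferInstance) h3
    have h5 : (J.comap (Ideal.Quotient.mk I)).IsMaximal := by
      rw [← h4]; infer_instance
    have h6 := Ideal.map_comap_of_surjective _ Ideal.Quotient.mk_surjective J
    rcases Ideal.map_eq_top_or_isMaximal_of_surjective (Ideal.Quotient.mk I)
      Ideal.Quotient.mk_surjective h5 with h7 | h7
    · rw [h6] at h7
      exact absurd h7 hJ.ne_top
    · rwa [h6] at h7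
  let _ : Module (R ⧸ I) M := Module.IsTorsionBySet.module
    ((Module.isTorsionBySet_iff_subset_annihilator R M).2 le_rfl)
  have : IsScalarTower R (R ⧸ I) M := Module.IsTorsionBySet.isScalarTower
    ((Module.isTorsionBySet_iff_subset_annihilator R M).2 le_rfl)
  have : Module.Finite (R ⧸ I) M := Module.Finite.of_restrictScalars_finite R _ _
  have h2 : IsArtinian (R ⧸ I) M := inferInstance
  exact isArtinian_of_surjective_algebraMap (R := R ⧸ I) Ideal.Quotient.mk_surjective

lemma cogen [IsLocalRing R] {E Q : Type} [AddCommGroup E] [Module R E] [AddCommGroup Q]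
    [Module R Q] (f : IsLocalRing.ResidueField R →ₗ[R] E) (hE : Module.Injective R E)
    (hf : Function.Injective f) (h : ∀ g : Q →ₗ[R] E, g = 0) (q : Q) : q = 0 := by
  by_contra hq
  let I := LinearMap.ker (LinearMap.toSpanSingleton R Q q)
  have hI : I ≤ IsLocalRing.maximalIdeal R := by
    apply IsLocalRing.le_maximalIdeal
    intro e
    have : (1 : R) ∈ I := by rw [e]; trivial
    apply hq
    simpa [I] using this
  let i : (R ⧸ I) →ₗ[R] Q := I.liftQ (LinearMap.toSpanSingleton R Q q) le_rfl
  have hi : Function.Injective i := by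
    rw [← LinearMap.ker_eq_bot]
    exact Submodule.ker_liftQ_eq_bot _ _ _ le_rfl
  let p : (R ⧸ I) →ₗ[R] IsLocalRing.ResidueField R :=
    I.liftQ (Algebra.linearMap R (IsLocalRing.ResidueField R)) (by
      intro r hr
      rw [LinearMap.mem_ker]
      exact Ideal.Quotient.eq_zero_iff_mem.2 (hI hr))
  obtain ⟨g, hg⟩ := hE.out i hi (f ∘ₗ p)
  have h1 := hg (Submodule.Quotient.mk 1)
  rw [h g] at h1
  have h2 : p (Submodule.Quotient.mk 1) = 1 :=
    (Submodule.liftQ_apply _ _ _).trans (by simp)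
  rw [LinearMap.comp_apply, h2, LinearMap.zero_apply, ← map_zero f] at h1
  exact one_ne_zero (hf h1).symm
abbrev Fy (Y : ModuleCat.{0} R) : ModuleCat.{0} R ⥤ (ModuleCat.{0} R)ᵒᵖ :=
  ((linearYoneda R (ModuleCat.{0} R)).obj Y).rightOp

abbrev KK {X : ModuleCat.{0} R} (P : ProjectiveResolution X) (Y : ModuleCat.{0} R) :
   ChainComplex (ModuleCat.{0} R)ᵒᵖ ℕ := ((Fy Y).mapHomologicalComplex _).obj P.complex

def cyc {X : ModuleCat.{0} R} (P : ProjectiveResolution X) (n : ℕ) (Y : ModuleCat.{0} R) :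
    Submodule R (P.complex.X n ⟶ Y) where
  carrier := {φ | P.complex.d (n+1) n ≫ φ = 0}
  zero_mem' := by simp
  add_mem' := by
    intro a b ha hb
    simp only [Set.mem_ofPred_eq] at *
    rw [Preadditive.comp_add, ha, hb, add_zero]
  smul_mem' := by
    intro r a ha
    simp only [Set.mem_ofPred_eq] at *
    rw [Linear.comp_smul, ha, smul_zero]

variable {X : ModuleCat.{0} R} (P : ProjectiveResolution X) (n : ℕ) (Y : ModuleCat.{0} R)

def pmap : ((KK P Y).opcycles n).unop →ₗ[R] (P.complex.X n ⟶ Y) :=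
  ((KK P Y).pOpcycles n).unop.hom

def hmap : ((KK P Y).opcycles n).unop →ₗ[R] ((KK P Y).homology n).unop :=
  ((KK P Y).homologyι n).unop.hom

lemma pmap_inj : Function.Injective (pmap P n Y) :=
  (ModuleCat.mono_iff_injective ((KK P Y).pOpcycles n).unop).1 inferInstance

lemma hmap_surj : Function.Surjective (hmap P n Y) :=
  (ModuleCat.epi_iff_surjective ((KK P Y).homologyι n).unop).1 inferInstance

lemma pmap_mem (z) : pmap P n Y z ∈ cyc P n Y := by
  have := congrArg Quiver.Hom.unop ((KK P Y).d_pOpcycles (n+1) n)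
  exact congrArg (fun f => f.hom z) this

lemma exists_pmap (φ : P.complex.X n ⟶ Y) (h : φ ∈ cyc P n Y) : ∃ z, pmap P n Y z = φ := by
  have h1 : (ShortComplex.mk _ _ ((KK P Y).d_pOpcycles (n+1) n)).Exact :=
    ShortComplex.exact_of_g_is_cokernel _ ((KK P Y).opcyclesIsCokernel (n+1) n (by simp))
  have h2 := h1.unop
  rw [ShortComplex.moduleCat_exact_iff] at h2
  exact h2 φ h

lemma hmap_zero (z) : hmap P n Y z = 0 ↔ ∃ ψ, P.complex.d n (n-1) ≫ ψ = pmap P n Y z := by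
  have h1 : (ShortComplex.mk ((KK P Y).homologyι n) ((KK P Y).fromOpcycles n (n-1))
      (by simp)).Exact :=
    ShortComplex.exact_of_f_is_kernel _ ((KK P Y).homologyIsKernel n (n-1) (by cases n <;> simp))
  have h2 := h1.unop
  have h3 := congrArg Quiver.Hom.unop ((KK P Y).p_fromOpcycles n (n-1))
  constructor
  · intro h
    rw [ShortComplex.moduleCat_exact_iff] at h2
    obtain ⟨w, hw⟩ := h2 z h
    refine ⟨w, ?_⟩
    refine Eq.trans ?_ (congrArg (pmap P n Y) hw)
    exact (congrArg (fun f => f.hom w) h3).symm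
  · rintro ⟨ψ, hψ⟩
    have h4 : ((KK P Y).fromOpcycles n (n-1)).unop.hom ψ = z := by
      apply pmap_inj
      refine Eq.trans ?_ hψ
      exact (congrArg (fun f => f.hom ψ) h3)
    rw [← h4]
    have h5 := congrArg Quiver.Hom.unop ((KK P Y).homologyι_comp_fromOpcycles n (n-1))
    exact (congrArg (fun f => f.hom ψ) h5)

abbrev ExtM (n : ℕ) (X Y : ModuleCat.{0} R) : ModuleCat.{0} R :=
  ((Ext R (ModuleCat.{0} R) n).obj (op X)).obj Y

def emap : ((KK P Y).homology n).unop →ₗ[R] ExtM n X Y :=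
  (P.isoLeftDerivedObj (Fy Y) n).hom.unop.hom

lemma emap_bij : Function.Bijective (emap P n Y) := by
  have : IsIso (P.isoLeftDerivedObj (Fy Y) n).hom.unop := inferInstance
  exact ConcreteCategory.bijective_of_isIso (P.isoLeftDerivedObj (Fy Y) n).hom.unop

def pe : ((KK P Y).opcycles n).unop ≃ₗ[R] cyc P n Y :=
  LinearEquiv.ofBijective ((pmap P n Y).codRestrict _ (pmap_mem P n Y))
   ⟨fun a b h => pmap_inj P n Y (congrArg Subtype.val h), fun ⟨φ, h⟩ => by
     obtain ⟨z, hz⟩ := exists_pmap P n Y φ h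
     exact ⟨z, Subtype.ext hz⟩⟩

def cls : cyc P n Y →ₗ[R] ExtM n X Y :=
  emap P n Y ∘ₗ hmap P n Y ∘ₗ (pe P n Y).symm.toLinearMap

lemma cls_surj : Function.Surjective (cls P n Y) := by
  intro y
  obtain ⟨w, rfl⟩ := (emap_bij P n Y).2 y
  obtain ⟨z, rfl⟩ := hmap_surj P n Y w
  exact ⟨pe P n Y z, by simp [cls]⟩

lemma cls_zero (φ) : cls P n Y φ = 0 ↔ ∃ ψ, P.complex.d n (n-1) ≫ ψ = φ.1 := by
  obtain ⟨z, rfl⟩ := (pe P n Y).surjective φ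
  have : cls P n Y (pe P n Y z) = emap P n Y (hmap P n Y z) := by simp [cls]
  rw [this, (injective_iff_map_eq_zero' _).1 (emap_bij P n Y).1, hmap_zero]
  rfl

variable {X' : ModuleCat.{0} R} (P' : ProjectiveResolution X')

lemma cls_nat (f : X ⟶ X') (g : P.complex ⟶ P'.complex)
    (w : g ≫ P'.π = P.π ≫ (ChainComplex.single₀ _).map f) (φ : cyc P' n Y) (φ' : cyc P n Y)
    (h : φ'.1 = g.f n ≫ φ.1) :
    (((Ext R (ModuleCat.{0} R) n).map f.op).app Y).hom (cls P' n Y φ) = cls P n Y φ' := by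
  obtain ⟨z, rfl⟩ := (pe P' n Y).surjective φ
  have e1 : cls P' n Y (pe P' n Y z) = emap P' n Y (hmap P' n Y z) := by simp [cls]
  obtain ⟨z', rfl⟩ := (pe P n Y).surjective φ'
  have e2 : cls P n Y (pe P n Y z') = emap P n Y (hmap P n Y z') := by simp [cls]
  rw [e1, e2]
  let G : KK P Y ⟶ KK P' Y := ((Fy Y).mapHomologicalComplex _).map g
  have hz : z' = (HomologicalComplex.opcyclesMap G n).unop.hom z := by
    apply pmap_inj
    refine Eq.trans h ?_
    have := congrArg Quiver.Hom.unop (HomologicalComplex.p_opcyclesMap G n)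
    exact (congrArg (fun f => f.hom z) this).symm
  have h1 := congrArg Quiver.Hom.unop (HomologicalComplex.homologyι_naturality G n)
  have h1' : (HomologicalComplex.homologyMap G n).unop.hom (hmap P' n Y z) = hmap P n Y z' := by
    rw [hz]
    exact (congrArg (fun f => f.hom z) h1)
  rw [← h1']
  have h3 : ((Fy Y).leftDerived n).map f ≫ (P'.isoLeftDerivedObj (Fy Y) n).hom =
      (P.isoLeftDerivedObj (Fy Y) n).hom ≫ HomologicalComplex.homologyMap G n := by
    refine ProjectiveResolution.isoLeftDerivedObj_hom_naturality f P P' g ?_ (Fy Y) n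
    rw [← HomologicalComplex.comp_f, w, HomologicalComplex.comp_f,
      ChainComplex.single₀_map_f_zero]
    rfl
  have h4 := congrArg Quiver.Hom.unop h3
  exact (congrArg (fun f => f.hom (hmap P' n Y z)) h4)

variable (𝔞 : Ideal R)

abbrev Q (t : ℕ) : ModuleCat.{0} R := ModuleCat.of R (R ⧸ 𝔞 ^ t)

abbrev Pr (t : ℕ) : ProjectiveResolution (Q 𝔞 t) := projectiveResolution (Q 𝔞 t)

abbrev H (n : ℕ) (Y : ModuleCat.{0} R) : ModuleCat.{0} R := (localCohomology 𝔞 n).obj Y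

def tr {t s : ℕ} (h : t ≤ s) : Q 𝔞 s ⟶ Q 𝔞 t :=
  ModuleCat.ofHom <| Submodule.mapQ _ _ LinearMap.id (Ideal.pow_le_pow_right h)

def T {t s : ℕ} (h : t ≤ s) : (Pr 𝔞 s).complex ⟶ (Pr 𝔞 t).complex :=
  ProjectiveResolution.lift (tr 𝔞 h) _ _

def inc (n : ℕ) (Y : ModuleCat.{0} R) (t : ℕ) : ExtM n (Q 𝔞 t) Y →ₗ[R] H 𝔞 n Y :=
  ((colimit.ι (localCohomology.diagram (localCohomology.idealPowersDiagram 𝔞) n)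
    (op (op t))).app Y).hom

def colim : IsColimit (((evaluation _ _).obj Y).mapCocone
    (colimit.cocone (localCohomology.diagram (localCohomology.idealPowersDiagram 𝔞) n))) :=
  isColimitOfPreserves _ (colimit.isColimit _)

lemma inc_surj (y : H 𝔞 n Y) : ∃ t z, inc 𝔞 n Y t z = y := by
  obtain ⟨j, z, h⟩ := Concrete.isColimit_exists_rep _ (colim n Y 𝔞) y
  exact ⟨j.unop.unop, z, h⟩

abbrev em {t s : ℕ} (h : t ≤ s) : ExtM n (Q 𝔞 t) Y →ₗ[R] ExtM n (Q 𝔞 s) Y :=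
  (((Ext R (ModuleCat.{0} R) n).map (tr 𝔞 h).op).app Y).hom

lemma inc_em {t s : ℕ} (h : t ≤ s) (z) : inc 𝔞 n Y s (em n Y 𝔞 h z) = inc 𝔞 n Y t z := by
  have := (((evaluation _ _).obj Y).mapCocone
    (colimit.cocone (localCohomology.diagram (localCohomology.idealPowersDiagram 𝔞) n))).w
    (homOfLE h).op.op
  exact congrArg (fun f => f.hom z) this

lemma inc_zero (t : ℕ) (z) (h : inc 𝔞 n Y t z = 0) :
    ∃ s, ∃ h : t ≤ s, em n Y 𝔞 h z = 0 := by
  have h0 : inc 𝔞 n Y t z = inc 𝔞 n Y t 0 := by rw [h, map_zero]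
  obtain ⟨k, f, g, hk⟩ := (Concrete.isColimit_rep_eq_iff_exists (i := op (op t)) (j := op (op t))
    _ (colim n Y 𝔞) z 0).1 h0
  refine ⟨k.unop.unop, f.unop.unop.le, ?_⟩
  exact hk.trans (map_zero _)

/-- class of a cocycle in local cohomology -/
def lc (t : ℕ) : cyc (Pr 𝔞 t) n Y →ₗ[R] H 𝔞 n Y := inc 𝔞 n Y t ∘ₗ cls (Pr 𝔞 t) n Y

lemma lc_surj (y : H 𝔞 n Y) : ∃ t φ, lc n Y 𝔞 t φ = y := by
  obtain ⟨t, z, rfl⟩ := inc_surj n Y 𝔞 y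
  obtain ⟨φ, rfl⟩ := cls_surj (Pr 𝔞 t) _ _ z
  exact ⟨t, φ, rfl⟩

lemma T_mem {t s : ℕ} (h : t ≤ s) {φ : (Pr 𝔞 t).complex.X n ⟶ Y} (hφ : φ ∈ cyc (Pr 𝔞 t) n Y) :
    (T 𝔞 h).f n ≫ φ ∈ cyc (Pr 𝔞 s) n Y := by
  change _ ≫ _ = _
  replace hφ : _ ≫ φ = 0 := hφ
  rw [← Category.assoc, ← HomologicalComplex.Hom.comm, Category.assoc, hφ, comp_zero]

lemma em_cls {t s : ℕ} (h : t ≤ s) (φ : cyc (Pr 𝔞 t) n Y) :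
    em n Y 𝔞 h (cls _ n Y φ) = cls _ n Y ⟨_, T_mem n Y 𝔞 h φ.2⟩ :=
  cls_nat (Pr 𝔞 s) n Y (Pr 𝔞 t) (tr 𝔞 h) (T 𝔞 h) (by simp [T]) _ _ rfl

lemma lc_T {t s : ℕ} (h : t ≤ s) (φ : cyc (Pr 𝔞 t) n Y) :
    lc n Y 𝔞 s ⟨_, T_mem n Y 𝔞 h φ.2⟩ = lc n Y 𝔞 t φ := by
  simp only [lc, LinearMap.comp_apply]
  rw [← em_cls, inc_em]

lemma lc_zero {t : ℕ} {φ : cyc (Pr 𝔞 t) n Y} (h0 : lc n Y 𝔞 t φ = 0) :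
    ∃ s, ∃ h : t ≤ s, ∃ ψ, (T 𝔞 h).f n ≫ φ.1 = (Pr 𝔞 s).complex.d n (n-1) ≫ ψ := by
  obtain ⟨s, h, h1⟩ := inc_zero _ _ _ _ _ h0
  rw [em_cls, cls_zero] at h1
  obtain ⟨ψ, h2⟩ := h1
  exact ⟨s, h, ψ, h2.symm⟩

lemma lc_eq_zero {t s : ℕ} {φ : cyc (Pr 𝔞 t) n Y} (h : t ≤ s) (ψ)
    (e : (T 𝔞 h).f n ≫ φ.1 = (Pr 𝔞 s).complex.d n (n-1) ≫ ψ) : lc n Y 𝔞 t φ = 0 := by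
  rw [← lc_T n Y 𝔞 h]
  simp only [lc, LinearMap.comp_apply]
  rw [(cls_zero _ _ _ _).2 ⟨ψ, e.symm⟩, map_zero]

lemma lc_torsion (t : ℕ) (φ : cyc (Pr 𝔞 t) n Y) (a : R) (ha : a ∈ 𝔞 ^ t) :
    a • lc n Y 𝔞 t φ = 0 := by
  rw [← map_smul]
  simp only [lc, LinearMap.comp_apply]
  have h1 := cls_nat (Pr 𝔞 t) n Y (Pr 𝔞 t) 0 0 (by simp) φ 0 (by simp)
  have h2 := cls_nat (Pr 𝔞 t) n Y (Pr 𝔞 t) 0 (a • 𝟙 _) (by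
    ext x
    simp only [HomologicalComplex.smul_f_apply, Linear.smul_comp, Category.id_comp, Functor.map_zero, comp_zero,
      HomologicalComplex.zero_f]
    have : ∀ z : Q 𝔞 t, a • z = 0 := by
      intro z
      obtain ⟨r, rfl⟩ := Ideal.Quotient.mk_surjective z
      rw [← Ideal.Quotient.mk_eq_mk, ← Submodule.Quotient.mk_smul]
      exact (Submodule.Quotient.mk_eq_zero _).2 (Ideal.mul_mem_right _ _ ha)
    exact this _) φ (a • φ) (by simp)
  rw [← h2, h1, map_zero, map_zero]

lemma torsion (y : H 𝔞 n Y) : ∃ t, ∀ a ∈ 𝔞 ^ t, a • y = 0 := by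
  obtain ⟨t, φ, rfl⟩ := lc_surj n Y 𝔞 y
  exact ⟨t, lc_torsion n Y 𝔞 t φ⟩

def aug (t : ℕ) : (Pr 𝔞 t).complex.X 0 ⟶ Q 𝔞 t := (Pr 𝔞 t).π.f 0

lemma d_aug (t : ℕ) : (Pr 𝔞 t).complex.d 1 0 ≫ aug 𝔞 t = 0 :=
  (Pr 𝔞 t).complex_d_comp_π_f_zero

lemma T_aug {t s : ℕ} (h : t ≤ s) :
    (T 𝔞 h).f 0 ≫ aug 𝔞 t = aug 𝔞 s ≫ tr 𝔞 h :=
  ProjectiveResolution.lift_commutes_zero _ _ _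

lemma epi_aug (t : ℕ) : Epi (aug 𝔞 t) :=
  inferInstanceAs (Epi ((Pr 𝔞 t).π.f 0))

lemma desc_aug (t : ℕ) (φ : (Pr 𝔞 t).complex.X 0 ⟶ Y) (h : (Pr 𝔞 t).complex.d 1 0 ≫ φ = 0) :
    ∃ u : Q 𝔞 t ⟶ Y, aug 𝔞 t ≫ u = φ :=
  ⟨(Pr 𝔞 t).exact₀.desc φ h, (Pr 𝔞 t).exact₀.g_desc _ _⟩

def h0c (t : ℕ) : (Q 𝔞 t ⟶ Y) →ₗ[R] cyc (Pr 𝔞 t) 0 Y where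
  toFun u := ⟨aug 𝔞 t ≫ u, by
    change _ ≫ _ ≫ _ = 0
    rw [← Category.assoc]
    exact (congrArg (· ≫ u) (d_aug 𝔞 t)).trans zero_comp⟩
  map_add' u v := Subtype.ext (Preadditive.comp_add _ _ _ _ _ _)
  map_smul' r u := Subtype.ext (Linear.comp_smul _ _ _ _ _ _)

def h0 (t : ℕ) : (Q 𝔞 t ⟶ Y) →ₗ[R] H 𝔞 0 Y := lc 0 Y 𝔞 t ∘ₗ h0c Y 𝔞 t

lemma h0_tr {t s : ℕ} (h : t ≤ s) (u : Q 𝔞 t ⟶ Y) : h0 Y 𝔞 s (tr 𝔞 h ≫ u) = h0 Y 𝔞 t u := by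
  simp only [h0, LinearMap.comp_apply]
  rw [← lc_T 0 Y 𝔞 h]
  refine congrArg (lc 0 Y 𝔞 s) (Subtype.ext ?_)
  change aug 𝔞 s ≫ tr 𝔞 h ≫ u = (T 𝔞 h).f 0 ≫ aug 𝔞 t ≫ u
  rw [← Category.assoc, ← Category.assoc, T_aug]

lemma h0_surj (y : H 𝔞 0 Y) : ∃ t u, h0 Y 𝔞 t u = y := by
  obtain ⟨t, φ, rfl⟩ := lc_surj 0 Y 𝔞 y
  obtain ⟨u, hu⟩ := desc_aug Y 𝔞 t φ.1 φ.2
  refine ⟨t, u, ?_⟩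
  change lc 0 Y 𝔞 t (h0c Y 𝔞 t u) = _
  exact congrArg (lc 0 Y 𝔞 t) (Subtype.ext hu)

lemma tr_surj {t s : ℕ} (h : t ≤ s) : Epi (tr 𝔞 h) := by
  rw [ModuleCat.epi_iff_surjective]
  intro z
  obtain ⟨r, rfl⟩ := Submodule.Quotient.mk_surjective _ z
  exact ⟨Submodule.Quotient.mk r, rfl⟩

lemma h0_inj (t : ℕ) (u : Q 𝔞 t ⟶ Y) (hu : h0 Y 𝔞 t u = 0) : u = 0 := by
  obtain ⟨s, h, ψ, e⟩ := lc_zero _ _ _ hu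
  have e1 : (T 𝔞 h).f 0 ≫ aug 𝔞 t ≫ u = 0 := by
    refine e.trans ?_
    simp
  rw [← Category.assoc, T_aug, Category.assoc] at e1
  have := tr_surj 𝔞 h
  have := epi_aug 𝔞 s
  rwa [← cancel_epi (tr 𝔞 h), ← cancel_epi (aug 𝔞 s), comp_zero, comp_zero]

def ofElt (t : ℕ) (m : Y) (hm : ∀ a ∈ 𝔞 ^ t, a • m = 0) : Q 𝔞 t ⟶ Y :=
  ModuleCat.ofHom (Submodule.liftQ _ (LinearMap.toSpanSingleton R Y m) (fun a ha => hm a ha))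

def one (t : ℕ) : Q 𝔞 t := Submodule.Quotient.mk 1

lemma hom_ext {t : ℕ} {u v : Q 𝔞 t ⟶ Y} (h : u.hom (one 𝔞 t) = v.hom (one 𝔞 t)) : u = v := by
  apply ModuleCat.hom_ext
  apply Submodule.linearMap_qext
  apply LinearMap.ext_ring
  exact h

lemma ofElt_one (t : ℕ) (m : Y) (hm) : (ofElt Y 𝔞 t m hm).hom (one 𝔞 t) = m := by
  refine (Submodule.liftQ_apply _ _ _).trans (by simp)

lemma smul_one' (t : ℕ) (u : Q 𝔞 t ⟶ Y) (a : R) (ha : a ∈ 𝔞 ^ t) : a • u.hom (one 𝔞 t) = 0 := by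
  rw [← map_smul]
  have : a • one 𝔞 t = 0 := by
    rw [one, ← Submodule.Quotient.mk_smul]
    exact (Submodule.Quotient.mk_eq_zero _).2 (Ideal.mul_mem_right _ _ ha)
  rw [this, map_zero]

lemma exists_regular [IsNoetherianRing R] [Module.Finite R Y] (h : Subsingleton (H 𝔞 0 Y)) :
    ∃ x ∈ 𝔞, IsSMulRegular Y x := by
  by_contra hcon
  push Not at hcon
  have h1 : (𝔞 : Set R) ⊆ ⋃ p ∈ associatedPrimes R Y, p := by
    rw [biUnion_associatedPrimes_eq_compl_regular]
    exact hcon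
  obtain ⟨p, hp, hle⟩ := (Ideal.subset_union_prime_finite (f := id) (associatedPrimes.finite R Y)
    0 0 (fun p hp _ _ => hp.1)).1 h1
  obtain ⟨hp1, m, hm⟩ := (isAssociatedPrime_iff_exists_injective_linearMap _ _).1 hp
  let m0 : Y := m (Submodule.Quotient.mk 1)
  have hm0 : ∀ a ∈ 𝔞 ^ 1, a • m0 = 0 := by
    intro a ha
    rw [pow_one] at ha
    rw [← map_smul, ← Submodule.Quotient.mk_smul, (Submodule.Quotient.mk_eq_zero _).2, map_zero]
    exact Ideal.mul_mem_right _ _ (hle ha)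
  have e := h0_inj Y 𝔞 1 (ofElt Y 𝔞 1 m0 hm0) (Subsingleton.elim _ _)
  have e1 := ofElt_one Y 𝔞 1 m0 hm0
  rw [e] at e1
  have e2 : m (Submodule.Quotient.mk 1) = m 0 := by
    rw [map_zero]; exact e1.symm
  have e3 := (Submodule.Quotient.mk_eq_zero _).1 (hm e2)
  exact hp1.ne_top ((Ideal.eq_top_iff_one _).2 e3)

lemma artinian_zero [IsNoetherianRing R] [IsLocalRing R] [Module.Finite R Y]
    (hs : Module.support R Y ∩ PrimeSpectrum.zeroLocus (𝔞 : Set R) ⊆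
      PrimeSpectrum.zeroLocus ((IsLocalRing.maximalIdeal R : Ideal R) : Set R)) :
    IsArtinian R (H 𝔞 0 Y) := by
  let G : ℕ →o Submodule R Y :=
    ⟨fun t => Submodule.torsionBySet R Y (𝔞 ^ t : Ideal R), fun s t h m hm => by
      rw [Submodule.mem_torsionBySet_iff] at *
      exact fun a => hm ⟨a.1, Ideal.pow_le_pow_right h a.2⟩⟩
  obtain ⟨t, ht⟩ := monotone_stabilizes_iff_noetherian.2 (inferInstance : IsNoetherian R Y) G
  let ev : (Q 𝔞 t ⟶ Y) →ₗ[R] Y :=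
    { toFun := fun u => u.hom (one 𝔞 t)
      map_add' := fun _ _ => rfl
      map_smul' := fun _ _ => rfl }
  have ev_inj : Function.Injective ev := fun u v h => hom_ext Y 𝔞 h
  have fin : Module.Finite R (Q 𝔞 t ⟶ Y) := Module.Finite.of_injective ev ev_inj
  have art : IsArtinian R (Q 𝔞 t ⟶ Y) := by
    apply artinian_of_support
    refine subset_trans (Set.subset_inter (Module.support_subset_of_injective ev ev_inj) ?_) hs
    intro p hp a ha
    have h1 := Module.annihilator_le_of_mem_support hp
    refine p.2.mem_of_pow_mem t (h1 ?_)
    rw [Module.mem_annihilator]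
    intro u
    apply hom_ext
    exact smul_one' Y 𝔞 t u _ (Ideal.pow_mem_pow ha t)
  refine isArtinian_of_surjective _ (h0 Y 𝔞 t) fun y => ?_
  obtain ⟨s, u, rfl⟩ := h0_surj Y 𝔞 y
  have hm : u.hom (one 𝔞 s) ∈ G s := by
    refine (Submodule.mem_torsionBySet_iff _ _).2 fun a => smul_one' Y 𝔞 s u a.1 a.2
  have hm' : u.hom (one 𝔞 s) ∈ G t := by
    rw [ht _ (le_max_left t s)]
    exact G.monotone (le_max_right t s) hm
  have hm2 := (Submodule.mem_torsionBySet_iff _ _).1 hm'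
  refine ⟨ofElt Y 𝔞 t _ (fun a ha => hm2 ⟨a, ha⟩), ?_⟩
  rw [← h0_tr Y 𝔞 (le_max_left t s), ← h0_tr Y 𝔞 (le_max_right t s)]
  congr 1
  apply hom_ext
  exact ofElt_one Y 𝔞 t _ (fun a ha => hm2 ⟨a, ha⟩)

structure Dat (x : R) (Y N : ModuleCat.{0} R) (π : Y ⟶ N) : Prop where
  reg : IsSMulRegular Y x
  surj : Function.Surjective π.hom
  zero : ∀ y : Y, π.hom (x • y) = 0
  ex : ∀ y : Y, π.hom y = 0 → ∃ z : Y, y = x • z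

section
variable {Y} {𝔞} {x : R} {N : ModuleCat.{0} R} {π : Y ⟶ N}

lemma Dat.cancel (D : Dat x Y N π) {A : ModuleCat.{0} R} {f g : A ⟶ Y} (h : x • f = x • g) : f = g := by
  ext a
  apply D.reg
  exact congrArg (fun k : A ⟶ Y => k.hom a) h

lemma Dat.divide (D : Dat x Y N π) {A : ModuleCat.{0} R} (f : A ⟶ Y) (h : f ≫ π = 0) : ∃ g : A ⟶ Y, f = x • g := by
  have h1 : ∀ a : A, ∃ z : Y, f.hom a = x • z := fun a => D.ex _
    (congrArg (fun k : A ⟶ N => k.hom a) h)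
  choose g hg using h1
  refine ⟨ModuleCat.ofHom
    { toFun := g
      map_add' := fun a b => D.reg (by
        change x • _ = x • _
        rw [← hg, smul_add, ← hg, ← hg, map_add])
      map_smul' := fun r a => D.reg (by
        change x • _ = x • _
        rw [← hg, RingHom.id_apply, smul_comm, ← hg, map_smul]) }, ?_⟩
  ext a
  exact hg a

lemma Dat.kill (D : Dat x Y N π) {A : ModuleCat.{0} R} (f : A ⟶ Y) : (x • f) ≫ π = 0 := by
  ext a
  exact D.zero (f.hom a)

lemma Dat.lift (D : Dat x Y N π) {A : ModuleCat.{0} R} [Projective A] (f : A ⟶ N) : ∃ g : A ⟶ Y, g ≫ π = f := by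
  have : Epi π := (ModuleCat.epi_iff_surjective _).2 D.surj
  exact ⟨Projective.factorThru f π, Projective.factorThru_comp _ _⟩

lemma T_d {t s : ℕ} (h : t ≤ s) (i j : ℕ) {Z : ModuleCat.{0} R} (f : (Pr 𝔞 t).complex.X j ⟶ Z) :
    (Pr 𝔞 s).complex.d i j ≫ (T 𝔞 h).f j ≫ f = (T 𝔞 h).f i ≫ (Pr 𝔞 t).complex.d i j ≫ f := by
  rw [← Category.assoc, ← HomologicalComplex.Hom.comm, Category.assoc]

lemma d_d (t i j k : ℕ) {Z : ModuleCat.{0} R} (f : (Pr 𝔞 t).complex.X k ⟶ Z) :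
    (Pr 𝔞 t).complex.d i j ≫ (Pr 𝔞 t).complex.d j k ≫ f = 0 := by
  rw [← Category.assoc, HomologicalComplex.d_comp_d, zero_comp]

/-- the connecting cocycle -/
lemma Dat.conn (D : Dat x Y N π) (t i : ℕ) (f : (Pr 𝔞 t).complex.X i ⟶ Y)
    (hf : f ≫ π ∈ cyc (Pr 𝔞 t) i N) :
    ∃ ψ ∈ cyc (Pr 𝔞 t) (i+1) Y, (Pr 𝔞 t).complex.d (i+1) i ≫ f = x • ψ := by
  obtain ⟨ψ, hψ⟩ := D.divide ((Pr 𝔞 t).complex.d (i+1) i ≫ f) (by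
    rw [Category.assoc]; exact hf)
  refine ⟨ψ, ?_, hψ⟩
  change _ ≫ ψ = 0
  apply D.cancel
  rw [← Linear.comp_smul, ← hψ, smul_zero, d_d]

lemma Dat.vanish (D : Dat x Y N π) (i : ℕ) (h1 : Subsingleton (H 𝔞 i Y)) (h2 : Subsingleton (H 𝔞 (i+1) Y)) :
    Subsingleton (H 𝔞 i N) := by
  refine subsingleton_of_forall_eq 0 fun y => ?_
  obtain ⟨t, φ, rfl⟩ := lc_surj i N 𝔞 y
  obtain ⟨φ, hφ⟩ := φ
  obtain ⟨f, rfl⟩ := D.lift φ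
  obtain ⟨ψ, hψ, e⟩ := D.conn t i f hφ
  obtain ⟨s, h, χ, e1⟩ := lc_zero (i+1) Y 𝔞 (φ := ⟨ψ, hψ⟩) (Subsingleton.elim _ _)
  change (Pr 𝔞 s).complex.X i ⟶ Y at χ
  change (T 𝔞 h).f (i+1) ≫ ψ = (Pr 𝔞 s).complex.d (i+1) i ≫ χ at e1
  have hc : (T 𝔞 h).f i ≫ f - x • χ ∈ cyc (Pr 𝔞 s) i Y := by
    change _ ≫ _ = 0
    rw [Preadditive.comp_sub, T_d, e, Linear.comp_smul, Linear.comp_smul, e1, sub_self]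
  obtain ⟨s', h', ξ, e2⟩ := lc_zero i Y 𝔞 (φ := ⟨_, hc⟩) (Subsingleton.elim _ _)
  rw [← lc_T i N 𝔞 h]
  refine lc_eq_zero i N 𝔞 h' (ξ ≫ π) ?_
  have e3 := congrArg (· ≫ π) e2
  simp only [Category.assoc, Preadditive.sub_comp, D.kill, sub_zero] at e3
  exact e3

def rel (x : R) (π : Y ⟶ N) (i t : ℕ) (u : H 𝔞 i N) (v : H 𝔞 (i+1) Y) : Prop :=
  ∃ (f : (Pr 𝔞 t).complex.X i ⟶ Y) (ψ : cyc (Pr 𝔞 t) (i+1) Y) (φ : cyc (Pr 𝔞 t) i N),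
    φ.1 = f ≫ π ∧ (Pr 𝔞 t).complex.d (i+1) i ≫ f = x • ψ.1 ∧ u = lc i N 𝔞 t φ ∧
      v = lc (i+1) Y 𝔞 t ψ

lemma rel_mono (D : Dat x Y N π) (i : ℕ) {t s : ℕ} (h : t ≤ s) {u : H 𝔞 i N} {v : H 𝔞 (i+1) Y}
    (hr : rel x π i t u v) : rel x π i s u v := by
  obtain ⟨f, ψ, φ, e1, e2, rfl, rfl⟩ := hr
  refine ⟨(T 𝔞 h).f i ≫ f, ⟨_, T_mem _ _ 𝔞 h ψ.2⟩, ⟨_, T_mem _ _ 𝔞 h φ.2⟩, ?_, ?_,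
    (lc_T _ _ _ h _).symm, (lc_T _ _ _ h _).symm⟩
  · rw [Category.assoc]; exact congrArg ((T 𝔞 h).f i ≫ ·) e1
  · rw [T_d, e2, Linear.comp_smul]

lemma rel_add (i : ℕ) {t : ℕ} {u u' : H 𝔞 i N} {v v' : H 𝔞 (i+1) Y}
    (hr : rel x π i t u v) (hr' : rel x π i t u' v') : rel x π i t (u + u') (v + v') := by
  obtain ⟨f, ψ, φ, e1, e2, rfl, rfl⟩ := hr
  obtain ⟨f', ψ', φ', e1', e2', rfl, rfl⟩ := hr'
  refine ⟨f + f', ψ + ψ', φ + φ', ?_, ?_, (map_add _ _ _).symm, (map_add _ _ _).symm⟩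
  · rw [Preadditive.add_comp, ← e1, ← e1']; rfl
  · rw [Preadditive.comp_add, e2, e2', ← smul_add]; rfl

lemma rel_smul (i : ℕ) {t : ℕ} (r : R) {u : H 𝔞 i N} {v : H 𝔞 (i+1) Y}
    (hr : rel x π i t u v) : rel x π i t (r • u) (r • v) := by
  obtain ⟨f, ψ, φ, e1, e2, rfl, rfl⟩ := hr
  refine ⟨r • f, r • ψ, r • φ, ?_, ?_, (map_smul _ _ _).symm, (map_smul _ _ _).symm⟩
  · rw [Linear.smul_comp, ← e1]; rfl
  · rw [Linear.comp_smul, e2, smul_comm]; rfl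

lemma Dat.rel_zero (D : Dat x Y N π) (i : ℕ) {t : ℕ} {v : H 𝔞 (i+1) Y}
    (hr : rel x π i t 0 v) : v = 0 := by
  obtain ⟨f, ψ, φ, e1, e2, e3, rfl⟩ := hr
  obtain ⟨s, h, χ, e4⟩ := lc_zero i N 𝔞 e3.symm
  obtain ⟨χ, rfl⟩ := D.lift χ
  obtain ⟨ξ, e5⟩ := D.divide ((T 𝔞 h).f i ≫ f - (Pr 𝔞 s).complex.d i (i-1) ≫ χ) (by
    rw [Preadditive.sub_comp, Category.assoc, Category.assoc, ← e1, e4, sub_self])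
  refine lc_eq_zero (i+1) Y 𝔞 h ξ ?_
  change _ = (Pr 𝔞 s).complex.d (i+1) i ≫ ξ
  apply D.cancel
  rw [← Linear.comp_smul, ← Linear.comp_smul, ← e5, ← e2, Preadditive.comp_sub, d_d, sub_zero,
    T_d]

lemma Dat.rel_ex (D : Dat x Y N π) (i : ℕ) (v : H 𝔞 (i+1) Y) (hv : x • v = 0) : ∃ t u, rel x π i t u v := by
  obtain ⟨t, ψ, rfl⟩ := lc_surj (i+1) Y 𝔞 v
  rw [← map_smul] at hv
  obtain ⟨s, h, f, e⟩ := lc_zero _ _ _ hv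
  change (Pr 𝔞 s).complex.X i ⟶ Y at f
  change (T 𝔞 h).f (i+1) ≫ (x • ψ.1) = (Pr 𝔞 s).complex.d (i+1) i ≫ f at e
  have hφ : f ≫ π ∈ cyc (Pr 𝔞 s) i N := by
    change _ ≫ _ ≫ _ = 0
    rw [← Category.assoc, ← e, Linear.comp_smul, D.kill]
  refine ⟨s, lc i N 𝔞 s ⟨_, hφ⟩, f, ⟨_, T_mem _ _ 𝔞 h ψ.2⟩, ⟨_, hφ⟩, rfl, ?_, rfl,
    (lc_T _ _ _ h _).symm⟩
  rw [← e, Linear.comp_smul]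

lemma Dat.art (D : Dat x Y N π) (i : ℕ) (hN : IsArtinian R (H 𝔞 i N)) :
    IsArtinian R (LinearMap.ker (LinearMap.lsmul R (H 𝔞 (i+1) Y) x)) := by
  let L : Submodule R (H 𝔞 i N × H 𝔞 (i+1) Y) :=
    { carrier := {p | ∃ t, rel x π i t p.1 p.2}
      zero_mem' := ⟨0, 0, 0, 0, by simp, by simp, by simp, by simp⟩
      add_mem' := by
        rintro a b ⟨t, ht⟩ ⟨s, hs⟩
        exact ⟨max t s, rel_add i (rel_mono D i (le_max_left _ _) ht)
          (rel_mono D i (le_max_right _ _) hs)⟩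
      smul_mem' := by
        rintro r a ⟨t, ht⟩
        exact ⟨t, rel_smul i r ht⟩ }
  let p1 : L →ₗ[R] H 𝔞 i N := LinearMap.fst R _ _ ∘ₗ L.subtype
  have hp1 : Function.Injective p1 := by
    rw [injective_iff_map_eq_zero]
    rintro ⟨⟨u, v⟩, t, ht⟩ (h : u = 0)
    subst h
    have := D.rel_zero i ht
    apply Subtype.ext
    exact Prod.ext rfl this
  have hL : IsArtinian R L := isArtinian_of_injective p1 hp1
  let p2 : L →ₗ[R] H 𝔞 (i+1) Y := LinearMap.snd R _ _ ∘ₗ L.subtype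
  have hr : IsArtinian R (LinearMap.range p2) := inferInstance
  refine isArtinian_of_le (t := LinearMap.range p2) ?_
  intro v hv
  obtain ⟨t, u, h⟩ := D.rel_ex i v hv
  exact ⟨⟨⟨u, v⟩, t, h⟩, rfl⟩

end

theorem artinian [IsNoetherianRing R] [IsLocalRing R] (c : ℕ) : ∀ (Y : ModuleCat.{0} R)
    [Module.Finite R Y] 
    (_ : Module.support R Y ∩ PrimeSpectrum.zeroLocus (𝔞 : Set R) ⊆
      PrimeSpectrum.zeroLocus ((IsLocalRing.maximalIdeal R : Ideal R) : Set R))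
    (_ : ∀ i < c, Subsingleton (H 𝔞 i Y)), IsArtinian R (H 𝔞 c Y) := by
  induction c with
  | zero => intro Y _ hs _; exact artinian_zero Y 𝔞 hs
  | succ c ih =>
    intro Y _ hs hv
    obtain ⟨x, hx, hreg⟩ := exists_regular Y 𝔞 (hv 0 (Nat.succ_pos _))
    let S : Submodule R Y := LinearMap.range (LinearMap.lsmul R Y x)
    let N : ModuleCat.{0} R := ModuleCat.of R (Y ⧸ S)
    let π : Y ⟶ N := ModuleCat.ofHom S.mkQ
    have D : Dat x Y N π :=
      { reg := hreg
        surj := S.mkQ_surjective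
        zero := fun y => (Submodule.Quotient.mk_eq_zero S).2 ⟨y, rfl⟩
        ex := fun y hy => by
          obtain ⟨z, hz⟩ := (Submodule.Quotient.mk_eq_zero S).1 hy
          exact ⟨z, hz.symm⟩ }
    have fN : Module.Finite R N := inferInstanceAs (Module.Finite R (Y ⧸ S))
    have aN := ih N
      (subset_trans (Set.inter_subset_inter_left _
        (Module.support_subset_of_surjective π.hom D.surj)) hs)
      (fun i hi => D.vanish i (hv i (by omega)) (hv (i+1) (by omega)))
    refine artinian_of_torsion x (fun y => ?_) (D.art c aN)
    obtain ⟨t, ht⟩ := torsion _ Y 𝔞 y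
    exact ⟨t, ht _ (Ideal.pow_mem_pow hx t)⟩

end
end LC

/-- Lemma 2.8: over a complete local ring, if `H^i_𝔞(M) = 0` for all `i < c`,
`Supp(M/𝔞M) ⊆ V(𝔪)` and `Hom_R(R/𝔞, D_R(H^c_𝔞(M))) = 0`, then `𝔞` contains a regular
element on `D_R(H^c_𝔞(M))`. -/
theorem stmt7 {R : Type} [CommRing R] [IsNoetherianRing R] [IsLocalRing R]
    [IsAdicComplete (IsLocalRing.maximalIdeal R) R]
    (𝔞 : Ideal R) (h𝔞 : 𝔞 ≠ ⊤)
    (M : Type) [AddCommGroup M] [Module R M] [Module.Finite R M]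
    (c : ℕ)
    (hvanish : ∀ i < c, Subsingleton ((localCohomology 𝔞 i).obj (ModuleCat.of R M)))
    (hsupp : Module.support R (M ⧸ (𝔞 • ⊤ : Submodule R M)) ⊆
      PrimeSpectrum.zeroLocus ((IsLocalRing.maximalIdeal R : Ideal R) : Set R))
    (E : Type) [AddCommGroup E] [Module R E]
    (f : IsLocalRing.ResidueField R →ₗ[R] E) (hE : IsInjectiveHull R f)
    (hhom : Subsingleton
      ((R ⧸ 𝔞) →ₗ[R] (((localCohomology 𝔞 c).obj (ModuleCat.of R M)) →ₗ[R] E))) :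
    ∃ x ∈ 𝔞, IsSMulRegular (((localCohomology 𝔞 c).obj (ModuleCat.of R M)) →ₗ[R] E) x := by
  have hart : IsArtinian R ((localCohomology 𝔞 c).obj (ModuleCat.of R M)) := by
    have fin : Module.Finite R (ModuleCat.of R M) := inferInstanceAs (Module.Finite R M)
    refine LC.artinian 𝔞 c (ModuleCat.of R M) ?_ hvanish
    rw [Module.support_quotient] at hsupp
    exact hsupp
  have htop : 𝔞 • (⊤ : Submodule R ((localCohomology 𝔞 c).obj (ModuleCat.of R M))) = ⊤ := by
    rw [← Submodule.Quotient.subsingleton_iff]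
    refine subsingleton_of_forall_eq 0 fun q => ?_
    refine LC.cogen f hE.injective hE.inj (fun g => ?_) q
    have h1 : ∀ a ∈ 𝔞, a • (g ∘ₗ Submodule.mkQ _) = 0 := by
      intro a ha
      ext z
      change a • g (Submodule.Quotient.mk z) = 0
      rw [← map_smul, ← Submodule.Quotient.mk_smul, (Submodule.Quotient.mk_eq_zero _).2, map_zero]
      exact Submodule.smul_mem_smul ha trivial
    have h2 := hhom.elim (Submodule.liftQ 𝔞 (LinearMap.toSpanSingleton R _
      (g ∘ₗ Submodule.mkQ (𝔞 • (⊤ : Submodule R ((localCohomology 𝔞 c).obj (ModuleCat.of R M))))))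
      (fun a ha => h1 a ha)) 0
    have h3 := LinearMap.congr_fun h2 (Submodule.Quotient.mk 1)
    apply Submodule.linearMap_qext
    refine Eq.trans ?_ h3
    exact (one_smul R (g ∘ₗ Submodule.mkQ _)).symm
  obtain ⟨x, hx, hsurj⟩ := LC.exists_surj 𝔞 htop
  refine ⟨x, hx, fun g g' h => ?_⟩
  ext y
  obtain ⟨z, rfl⟩ := hsurj y
  rw [map_smul, map_smul]
  exact LinearMap.congr_fun h z
end
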